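/- Let R be a Henselian local ring with residue field κ, and let g : W → Spec R be a proper morphism of schemes with W nonempty and connected. Then the closed fiber W ×_{Spec R} Spec κ is nonempty and connected. -/

import Mathlib

universe u v

namespace Subalgebra

variable {R A : Type*} [CommRing R] [CommRing A] [Algebra R A]

/-- Products respect the `I`-adic filtration of a subalgebra. -/
lemma mul_mem_mul_smul (B : Subalgebra R A) {I J : Ideal R} {x y : A}
    (hx : x ∈ I • B.toSubmodule) (hy : y ∈ J • B.toSubmodule) :
    x * y ∈ (I * J) • B.toSubmodule := by
  induction hx using Submodule.smul_induction_on' with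
  | smul r hr n hn =>
    induction hy using Submodule.smul_induction_on' with
    | smul s hs k hk =>
      rw [smul_mul_smul_comm]
      exact Submodule.smul_mem_smul (Ideal.mul_mem_mul hr hs) (B.mul_mem hn hk)
    | add y _ y' _ h h' => rw [mul_add]; exact add_mem h h'
  | add x _ x' _ h h' => rw [add_mul]; exact add_mem h h'

lemma mul_mem_smul (B : Subalgebra R A) {I : Ideal R} {x y : A}
    (hx : x ∈ I • B.toSubmodule) (hy : y ∈ B) : x * y ∈ I • B.toSubmodule := by
  have := B.mul_mem_mul_smul (J := ⊤) hx (by simpa using hy)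
  rwa [Ideal.mul_top] at this

lemma exists_idempotent_approx (B₀ B₁ B₂ : Subalgebra R A) (h₀ : B₀ ≤ B₂) (h₁ : B₁ ≤ B₂)
    (I : Ideal R) {f₀ f₁ : A} (hf₀ : f₀ ∈ B₀) (hf₁ : f₁ ∈ B₁)
    (e₀ : f₀ ^ 2 - f₀ ∈ I • B₀.toSubmodule) (e₁ : f₁ ^ 2 - f₁ ∈ I • B₁.toSubmodule)
    (e₂ : f₀ - f₁ ∈ I • B₂.toSubmodule) (n : ℕ) :
    ∃ g₀ ∈ B₀, ∃ g₁ ∈ B₁, g₀ - f₀ ∈ I • B₀.toSubmodule ∧ g₁ - f₁ ∈ I • B₁.toSubmodule ∧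
      g₀ ^ 2 - g₀ ∈ I ^ (n + 1) • B₀.toSubmodule ∧ g₁ ^ 2 - g₁ ∈ I ^ (n + 1) • B₁.toSubmodule ∧
      g₀ - g₁ ∈ I ^ (n + 1) • B₂.toSubmodule := by
  induction n with
  | zero => exact ⟨f₀, hf₀, f₁, hf₁, by simp, by simp, by simpa, by simpa, by simpa⟩
  | succ n ih =>
    obtain ⟨g₀, hg₀, g₁, hg₁, d₀, d₁, s₀, s₁, s₂⟩ := ih
    have hI : I ^ (n + 1) * I ^ (n + 1) ≤ I ^ (n + 1 + 1) := by
      rw [← pow_add]; exact Ideal.pow_le_pow_right (by omega)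
    have hI' : I ^ (n + 1) ≤ I := Ideal.pow_le_self (by omega)
    have key (B : Subalgebra R A) (g : A) (hg : g ∈ B)
        (s : g ^ 2 - g ∈ I ^ (n + 1) • B.toSubmodule) :
        3 * g ^ 2 - 2 * g ^ 3 ∈ B ∧ 3 * g ^ 2 - 2 * g ^ 3 - g ∈ I • B.toSubmodule ∧
        (3 * g ^ 2 - 2 * g ^ 3) ^ 2 - (3 * g ^ 2 - 2 * g ^ 3) ∈
          I ^ (n + 1 + 1) • B.toSubmodule := by
      have h3 : (3 : A) ∈ B := by exact_mod_cast B.natCast_mem 3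
      have h2 : (2 : A) ∈ B := by exact_mod_cast B.natCast_mem 2
      have h4 : (4 : A) ∈ B := by exact_mod_cast B.natCast_mem 4
      refine ⟨sub_mem (mul_mem h3 (pow_mem hg 2)) (mul_mem h2 (pow_mem hg 3)), ?_, ?_⟩
      · rw [show 3 * g ^ 2 - 2 * g ^ 3 - g = (g ^ 2 - g) * (1 - 2 * g) by ring]
        exact Submodule.smul_mono_left hI'
          (B.mul_mem_smul s (sub_mem B.one_mem (mul_mem h2 hg)))
      · rw [show (3 * g ^ 2 - 2 * g ^ 3) ^ 2 - (3 * g ^ 2 - 2 * g ^ 3) =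
          ((g ^ 2 - g) * (g ^ 2 - g)) * (4 * g ^ 2 - 4 * g - 3) by ring]
        exact Submodule.smul_mono_left hI (B.mul_mem_smul (B.mul_mem_mul_smul s s)
          (sub_mem (sub_mem (mul_mem h4 (pow_mem hg 2)) (mul_mem h4 hg)) h3))
    obtain ⟨a₀, b₀, c₀⟩ := key B₀ g₀ hg₀ s₀
    obtain ⟨a₁, b₁, c₁⟩ := key B₁ g₁ hg₁ s₁
    refine ⟨_, a₀, _, a₁, ?_, ?_, c₀, c₁, ?_⟩
    · simpa using add_mem b₀ d₀
    · simpa using add_mem b₁ d₁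
    · have h3 : (3 : A) ∈ B₂ := by exact_mod_cast B₂.natCast_mem 3
      have h2 : (2 : A) ∈ B₂ := by exact_mod_cast B₂.natCast_mem 2
      have h6 : (6 : A) ∈ B₂ := by exact_mod_cast B₂.natCast_mem 6
      have k₁ : g₁ ^ 2 - g₁ ∈ I ^ (n + 1) • B₂.toSubmodule := Submodule.smul_mono le_rfl h₁ s₁
      have m₁ := h₁ hg₁
      have m₀ := h₀ hg₀
      rw [show 3 * g₀ ^ 2 - 2 * g₀ ^ 3 - (3 * g₁ ^ 2 - 2 * g₁ ^ 3) =
        ((g₀ - g₁) * (g₁ ^ 2 - g₁)) * (-6) +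
          ((g₀ - g₁) * (g₀ - g₁)) * (3 - 6 * g₁ - 2 * (g₀ - g₁)) by ring]
      exact Submodule.smul_mono_left hI (add_mem
        (B₂.mul_mem_smul (B₂.mul_mem_mul_smul s₂ k₁) (neg_mem h6))
        (B₂.mul_mem_smul (B₂.mul_mem_mul_smul s₂ s₂)
          (sub_mem (sub_mem h3 (mul_mem h6 m₁)) (mul_mem h2 (sub_mem m₀ m₁)))))

theorem exists_one_sub_smul_mem_of_sup_eq [IsNoetherianRing R] (B₀ B₁ B₂ : Subalgebra R A)
    (h₀ : B₀ ≤ B₂) (h₁ : B₁ ≤ B₂) (F : Submodule R A) (hF : F.FG)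
    (hF' : B₂.toSubmodule ≤ B₀.toSubmodule ⊔ B₁.toSubmodule ⊔ F)
    (I : Ideal R) {f₀ f₁ : A} (hf₀ : f₀ ∈ B₀) (hf₁ : f₁ ∈ B₁)
    (e₀ : f₀ ^ 2 - f₀ ∈ I • B₀.toSubmodule) (e₁ : f₁ ^ 2 - f₁ ∈ I • B₁.toSubmodule)
    (e₂ : f₀ - f₁ ∈ I • B₂.toSubmodule) :
    ∃ r ∈ I, (1 - r) • (f₀ - f₁) ∈ I • B₀.toSubmodule ⊔ I • B₁.toSubmodule := by
  set N := I • B₀.toSubmodule ⊔ I • B₁.toSubmodule with hN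
  -- the first Čech cohomology of the ideal generated by `I`
  set Q : Submodule R (A ⧸ N) := (I • B₂.toSubmodule).map N.mkQ with hQ
  have hQF : Q ≤ (I • F).map N.mkQ := by
    rw [hQ, Submodule.map_le_iff_le_comap, Submodule.comap_map_mkQ]
    refine (Submodule.smul_mono le_rfl hF').trans ?_
    rw [Submodule.smul_sup, Submodule.smul_sup]
  have : Module.Finite R Q := Module.Finite.iff_fg.mpr <|
    Submodule.FG.of_le ((Submodule.FG.of_le hF Submodule.smul_le_right).map _) hQF
  let x : Q := ⟨N.mkQ (f₀ - f₁), Submodule.mem_map_of_mem e₂⟩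
  have hx : x ∈ (⨅ i : ℕ, I ^ i • ⊤ : Submodule R Q) := by
    rw [Submodule.mem_iInf]
    intro n
    obtain ⟨g₀, -, g₁, -, d₀, d₁, -, -, s₂⟩ :=
      exists_idempotent_approx B₀ B₁ B₂ h₀ h₁ I hf₀ hf₁ e₀ e₁ e₂ n
    have hx' : N.mkQ (f₀ - f₁) = N.mkQ (g₀ - g₁) := by
      rw [← sub_eq_zero, ← map_sub, Submodule.mkQ_apply, Submodule.Quotient.mk_eq_zero,
        show f₀ - f₁ - (g₀ - g₁) = -(g₀ - f₀) + (g₁ - f₁) by ring]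
      exact add_mem (Submodule.mem_sup_left (neg_mem d₀)) (Submodule.mem_sup_right d₁)
    have : x.1 ∈ (I ^ n • (⊤ : Submodule R Q)).map Q.subtype := by
      rw [Submodule.map_smul'', Submodule.map_top, Submodule.range_subtype]
      change N.mkQ (f₀ - f₁) ∈ _
      rw [hx', hQ, ← Submodule.map_smul'', ← Submodule.mul_smul, ← pow_succ]
      exact Submodule.mem_map_of_mem s₂
    obtain ⟨y, hy, hyx⟩ := this
    rwa [← Subtype.ext hyx]
  obtain ⟨r, hr⟩ := (I.mem_iInf_smul_pow_eq_bot_iff x).mp hx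
  refine ⟨r, r.2, ?_⟩
  have := congr_arg Subtype.val hr
  change (r : R) • N.mkQ (f₀ - f₁) = N.mkQ (f₀ - f₁) at this
  rw [← Submodule.Quotient.mk_eq_zero N, sub_smul, one_smul, ← Submodule.mkQ_apply, map_sub,
    map_smul, this, sub_self]
end Subalgebra

section

open Polynomial

namespace Subring

variable {L : Type*} [Field L]

lemma isIntegral_iff_exists_monic {C : Subring L} {x : L} :
    IsIntegral C x ↔ ∃ p : L[X], p.Monic ∧ (∀ i, p.coeff i ∈ C) ∧ p.eval x = 0 := by
  constructor
  · rintro ⟨p, hp, hx⟩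
    refine ⟨p.map C.subtype, hp.map _, fun i ↦ by simp, ?_⟩
    rw [eval_map]; exact hx
  · rintro ⟨p, hp, hc, hx⟩
    have hc' : (↑p.coeffs : Set L) ⊆ C := by
      intro y hy
      obtain ⟨n, -, rfl⟩ := mem_coeffs_iff.mp hy
      exact hc n
    refine ⟨p.toSubring C hc', (monic_toSubring _ _ _).mpr hp, ?_⟩
    change eval₂ C.subtype x _ = 0
    rw [← eval_map]
    convert hx using 2
    ext; simp

lemma isIntegral_mono {C D : Subring L} (h : C ≤ D) {x : L} (hx : IsIntegral C x) :
    IsIntegral D x := by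
  obtain ⟨p, hp, hc, hx⟩ := isIntegral_iff_exists_monic.mp hx
  exact isIntegral_iff_exists_monic.mpr ⟨p, hp, fun i ↦ h (hc i), hx⟩

/-- The integral closure in a field of the subring generated by a set. -/
def intClosure (C : Set L) : Subring L := (integralClosure (closure C) L).toSubring

lemma mem_intClosure {C : Set L} {x : L} : x ∈ intClosure C ↔ IsIntegral (closure C) x := Iff.rfl

lemma closure_le_intClosure (C : Set L) : closure C ≤ intClosure C :=
  fun x hx ↦ isIntegral_algebraMap (x := (⟨x, hx⟩ : closure C))

lemma subset_intClosure (C : Set L) : C ⊆ intClosure C :=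
  subset_closure.trans (closure_le_intClosure C)

lemma intClosure_mono {C D : Set L} (h : C ⊆ D) : intClosure C ≤ intClosure D :=
  fun _ hx ↦ isIntegral_mono (closure_mono h) hx

instance (C : Set L) : IsIntegrallyClosedIn (intClosure C) L :=
  inferInstanceAs (IsIntegrallyClosedIn (integralClosure (closure C) L).toSubring L)

lemma mem_of_isIntegral {T : Subring L} [IsIntegrallyClosedIn T L] {x : L} (h : IsIntegral T x) :
    x ∈ T := by
  obtain ⟨y, rfl⟩ := IsIntegrallyClosedIn.isIntegral_iff.mp h
  exact y.2

lemma intClosure_le {C : Set L} {T : Subring L} [IsIntegrallyClosedIn T L] (h : C ⊆ T) :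
    intClosure C ≤ T :=
  fun _ hx ↦ mem_of_isIntegral (isIntegral_mono (closure_le.mpr h) hx)

lemma exists_finite_of_mem_closure {C : Set L} {x : L} (hx : x ∈ closure C) :
    ∃ s : Set L, s.Finite ∧ s ⊆ C ∧ x ∈ closure s := by
  induction hx using closure_induction with
  | mem x hx => exact ⟨{x}, by simp, by simpa, subset_closure (by simp)⟩
  | zero => exact ⟨∅, by simp, by simp, zero_mem _⟩
  | one => exact ⟨∅, by simp, by simp, one_mem _⟩
  | add x y _ _ hx hy =>
    obtain ⟨s, hs, hsC, hx⟩ := hx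
    obtain ⟨t, ht, htC, hy⟩ := hy
    exact ⟨s ∪ t, hs.union ht, Set.union_subset hsC htC, add_mem
      (closure_mono Set.subset_union_left hx) (closure_mono Set.subset_union_right hy)⟩
  | mul x y _ _ hx hy =>
    obtain ⟨s, hs, hsC, hx⟩ := hx
    obtain ⟨t, ht, htC, hy⟩ := hy
    exact ⟨s ∪ t, hs.union ht, Set.union_subset hsC htC, mul_mem
      (closure_mono Set.subset_union_left hx) (closure_mono Set.subset_union_right hy)⟩
  | neg x _ hx =>
    obtain ⟨s, hs, hsC, hx⟩ := hx
    exact ⟨s, hs, hsC, neg_mem hx⟩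

lemma exists_finite_of_mem_intClosure {C : Set L} {x : L} (hx : x ∈ intClosure C) :
    ∃ s : Set L, s.Finite ∧ s ⊆ C ∧ x ∈ intClosure s := by
  obtain ⟨p, hp, hc, hx⟩ := isIntegral_iff_exists_monic.mp hx
  choose s hs hsC hps using fun i ↦ exists_finite_of_mem_closure (hc i)
  refine ⟨⋃ i ∈ p.support, s i, p.support.finite_toSet.biUnion fun i _ ↦ hs i,
    Set.iUnion₂_subset fun i _ ↦ hsC i, isIntegral_iff_exists_monic.mpr ⟨p, hp, fun i ↦ ?_, hx⟩⟩
  by_cases hi : i ∈ p.support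
  · exact closure_mono (Set.subset_biUnion_of_mem (u := s) (by simpa using hi)) (hps i)
  · rw [notMem_support_iff.mp hi]; exact zero_mem _

/-- Finitely many integral elements are already integral over a finitely generated subring. -/
lemma exists_finite_of_subset_intClosure {C X : Set L} (hX : X.Finite) (h : X ⊆ intClosure C) :
    ∃ s : Set L, s.Finite ∧ s ⊆ C ∧ X ⊆ intClosure s := by
  choose! s hs hsC hxs using fun x (hx : x ∈ X) ↦ exists_finite_of_mem_intClosure (h hx)
  exact ⟨⋃ x ∈ X, s x, hX.biUnion hs, Set.iUnion₂_subset hsC,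
    fun x hx ↦ intClosure_mono (Set.subset_biUnion_of_mem (u := s) hx) (hxs x hx)⟩

lemma exists_pow_mul_mem_closure {s : Set L} {t : L} (ht : t ≠ 0) {c : L}
    (hc : c ∈ closure (s ∪ {t, t⁻¹})) : ∃ n : ℕ, ∀ k ≥ n, t ^ k * c ∈ closure (s ∪ {t}) := by
  have ht' : t ∈ closure (s ∪ {t}) := subset_closure (by simp)
  induction hc using closure_induction with
  | mem x hx =>
    rcases hx with hx | rfl | rfl
    · exact ⟨0, fun k _ ↦ mul_mem (pow_mem ht' _) (subset_closure (.inl hx))⟩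
    · exact ⟨0, fun k _ ↦ mul_mem (pow_mem ht' _) ht'⟩
    · refine ⟨1, fun k hk ↦ ?_⟩
      obtain ⟨k, rfl⟩ := Nat.exists_eq_add_of_le hk
      rw [show t ^ (1 + k) * t⁻¹ = t ^ k by rw [pow_add]; field_simp]
      exact pow_mem ht' _
  | zero => exact ⟨0, fun k _ ↦ by simp [zero_mem]⟩
  | one => exact ⟨0, fun k _ ↦ by simpa using pow_mem ht' _⟩
  | add x y _ _ hx hy =>
    obtain ⟨n, hn⟩ := hx
    obtain ⟨m, hm⟩ := hy
    refine ⟨n + m, fun k hk ↦ ?_⟩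
    rw [mul_add]
    exact add_mem (hn k (by omega)) (hm k (by omega))
  | mul x y _ _ hx hy =>
    obtain ⟨n, hn⟩ := hx
    obtain ⟨m, hm⟩ := hy
    refine ⟨n + m, fun k hk ↦ ?_⟩
    obtain ⟨k, rfl⟩ := Nat.exists_eq_add_of_le hk
    rw [show t ^ (n + m + k) * (x * y) = (t ^ (n + k) * x) * (t ^ m * y) by ring]
    exact mul_mem (hn _ (by omega)) (hm m le_rfl)
  | neg x _ hx =>
    obtain ⟨n, hn⟩ := hx
    exact ⟨n, fun k hk ↦ by simpa using hn k hk⟩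

lemma exists_pow_mul_mem_intClosure {s : Set L} {t : L} (ht : t ≠ 0) {y : L}
    (hy : y ∈ intClosure (s ∪ {t, t⁻¹})) :
    ∃ n : ℕ, ∀ k ≥ n, t ^ k * y ∈ intClosure (s ∪ {t}) := by
  obtain ⟨p, hp, hc, hx⟩ := isIntegral_iff_exists_monic.mp hy
  have ht' : t ∈ closure (s ∪ {t}) := subset_closure (by simp)
  choose n hn using fun i ↦ exists_pow_mul_mem_closure ht (hc i)
  set N := p.support.sup n
  have key : t ^ N * y ∈ intClosure (s ∪ {t}) := by
    refine isIntegral_iff_exists_monic.mpr ⟨p.scaleRoots (t ^ N),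
      (monic_scaleRoots_iff _).mpr hp, fun i ↦ ?_, ?_⟩
    · rw [coeff_scaleRoots, mul_comm]
      by_cases hi : i ∈ p.support
      · obtain h | h := (le_natDegree_of_mem_supp i hi).lt_or_eq
        · rw [← pow_mul]
          exact hn i _ ((Finset.le_sup hi).trans (Nat.le_mul_of_pos_right _ (by omega)))
        · rw [h]; simp [hp.coeff_natDegree, one_mem]
      · rw [notMem_support_iff.mp hi]; simp [zero_mem]
    · have := scaleRoots_eval₂_eq_zero (RingHom.id L) (s := t ^ N) (p := p) (r := y) hx
      simpa using this
  refine ⟨N, fun k hk ↦ ?_⟩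
  obtain ⟨k, rfl⟩ := Nat.exists_eq_add_of_le hk
  rw [show t ^ (N + k) * y = t ^ k * (t ^ N * y) by ring]
  exact mul_mem (pow_mem (closure_le_intClosure _ ht') _) key

/-- Laurent monomials span the ring generated by an invertible element. -/
lemma adjoin_pair_inv_le_span {R : Type*} [CommRing R] [Algebra R L] {t : L} (ht : t ≠ 0) :
    (Algebra.adjoin R {t, t⁻¹}).toSubmodule ≤ Submodule.span R (Set.range fun k : ℤ ↦ t ^ k) := by
  rw [Algebra.adjoin_eq_span]
  refine Submodule.span_mono ?_
  intro x hx
  induction hx using Submonoid.closure_induction with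
  | mem x hx =>
    rcases hx with rfl | rfl
    · exact ⟨1, by simp⟩
    · exact ⟨-1, by simp⟩
  | one => exact ⟨0, by simp⟩
  | mul x y _ _ hx hy =>
    obtain ⟨a, rfl⟩ := hx
    obtain ⟨b, rfl⟩ := hy
    exact ⟨a + b, zpow_add₀ ht a b⟩

/-- A finite algebra over Laurent polynomials has finitely generated first Čech cohomology. -/
lemma exists_fg_le_sup_inf {R : Subring L} {t : L} (ht : t ≠ 0) {X : Set L}
    (hX : X.Finite) (hX' : X ⊆ intClosure (R ∪ {t, t⁻¹})) (T₀ T₁ B : Subalgebra R L)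
    (h₀ : (intClosure (R ∪ {t}) : Set L) ⊆ T₀) (h₁ : (intClosure (R ∪ {t⁻¹}) : Set L) ⊆ T₁)
    (hB : B = Algebra.adjoin R ({t, t⁻¹} ∪ X)) :
    ∃ F : Submodule R L, F.FG ∧
      B.toSubmodule ≤ (B ⊓ T₀).toSubmodule ⊔ (B ⊓ T₁).toSubmodule ⊔ F := by
  set C := Algebra.adjoin R ({t, t⁻¹} : Set L)
  have hC : C.toSubring = closure (R ∪ {t, t⁻¹}) := by
    rw [Algebra.adjoin_eq_ring_closure]
    congr 2
    exact Subtype.range_coe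
  have hInt {x : L} (hx : x ∈ intClosure (R ∪ {t, t⁻¹})) : IsIntegral C x := by
    rw [mem_intClosure, ← hC] at hx
    exact hx
  have hInt' {x : L} (hx : IsIntegral C x) : x ∈ intClosure (R ∪ {t, t⁻¹}) := by
    rw [mem_intClosure, ← hC]
    exact hx
  obtain ⟨Y, hY⟩ := fg_adjoin_of_finite (R := C) hX fun x hx ↦ hInt (hX' hx)
  have hB' : (Algebra.adjoin C X).restrictScalars R = B := by
    rw [hB, Algebra.adjoin_union_eq_adjoin_adjoin]
  have hYB {y : L} (hy : y ∈ Y) : y ∈ B := by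
    rw [← hB']
    change y ∈ (Algebra.adjoin C X).toSubmodule
    rw [← hY]; exact Submodule.subset_span hy
  have htB (k : ℤ) : t ^ k ∈ B := by
    have h1 : t ∈ B := hB ▸ Algebra.subset_adjoin (by simp)
    have h2 : t⁻¹ ∈ B := hB ▸ Algebra.subset_adjoin (by simp)
    cases k with
    | ofNat k => simpa using pow_mem h1 k
    | negSucc k => rw [zpow_negSucc, ← inv_pow]; exact pow_mem h2 _
  have hYint {y : L} (hy : y ∈ Y) : y ∈ intClosure (R ∪ {t, t⁻¹}) := by
    refine hInt' ?_
    have : y ∈ Algebra.adjoin C X := by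
      change y ∈ (Algebra.adjoin C X).toSubmodule
      rw [← hY]; exact Submodule.subset_span hy
    exact (Algebra.adjoin_le (S := integralClosure C L) fun x hx ↦ hInt (hX' hx)) this
  choose! n hn using fun y (hy : y ∈ Y) ↦ exists_pow_mul_mem_intClosure ht (hYint hy)
  choose! m hm using fun y (hy : y ∈ Y) ↦ exists_pow_mul_mem_intClosure (inv_ne_zero ht)
    (s := R) (by rw [inv_inv, Set.pair_comm]; exact hYint hy)
  set N := Y.sup n + Y.sup m
  refine ⟨Submodule.span R ((fun q : ℤ × L ↦ t ^ q.1 * q.2) '' (Set.Icc (-N : ℤ) N ×ˢ Y)),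
    Submodule.fg_span (((Set.finite_Icc _ _).prod Y.finite_toSet).image _), ?_⟩
  have hBspan : B.toSubmodule ≤ Submodule.span R (Set.range fun k : ℤ ↦ t ^ k) *
      Submodule.span R (Y : Set L) := by
    intro b hb
    replace hb : b ∈ Submodule.span C (Y : Set L) := by
      rw [hY]; rw [← hB'] at hb; exact hb
    induction hb using Submodule.span_induction with
    | mem y hy =>
      rw [← one_mul y]
      exact Submodule.mul_mem_mul (Submodule.subset_span ⟨0, by simp⟩) (Submodule.subset_span hy)
    | zero => exact zero_mem _
    | add x y _ _ hx hy => exact add_mem hx hy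
    | smul c x _ hx =>
      have : (c • x : L) ∈ Submodule.span R (Set.range fun k : ℤ ↦ t ^ k) *
          (Submodule.span R (Set.range fun k : ℤ ↦ t ^ k) * Submodule.span R (Y : Set L)) :=
        Submodule.mul_mem_mul (adjoin_pair_inv_le_span ht c.2) hx
      rw [← mul_assoc, Submodule.span_mul_span] at this
      refine (mul_le_mul' (Submodule.span_mono ?_) le_rfl : _ ≤ _) this
      rintro _ ⟨_, ⟨a, rfl⟩, _, ⟨b, rfl⟩, rfl⟩
      exact ⟨a + b, zpow_add₀ ht a b⟩
  refine hBspan.trans ?_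
  rw [Submodule.span_mul_span, Submodule.span_le]
  rintro _ ⟨_, ⟨k, rfl⟩, y, hy, rfl⟩
  have hkB : t ^ k * y ∈ B := mul_mem (htB k) (hYB hy)
  have hny : n y ≤ Y.sup n := Finset.le_sup hy
  have hmy : m y ≤ Y.sup m := Finset.le_sup hy
  by_cases h : k ∈ Set.Icc (-N : ℤ) N
  · exact Submodule.mem_sup_right (Submodule.subset_span ⟨(k, y), ⟨h, hy⟩, rfl⟩)
  · rw [Set.mem_Icc, not_and_or, not_le, not_le] at h
    refine Submodule.mem_sup_left ?_
    obtain h | h := h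
    · refine Submodule.mem_sup_right ⟨hkB, h₁ ?_⟩
      obtain ⟨l, rfl⟩ : ∃ l : ℕ, k = -l := ⟨k.natAbs, by omega⟩
      simpa using hm y hy l (by omega)
    · refine Submodule.mem_sup_left ⟨hkB, h₀ ?_⟩
      obtain ⟨l, rfl⟩ : ∃ l : ℕ, k = l := ⟨k.natAbs, by omega⟩
      simpa using hn y hy l (by omega)

lemma exists_finite_of_mem_span {T : Subring L} {M : Set L} {f : L}
    (hf : f ∈ Submodule.span T M) :
    ∃ A N : Set L, A.Finite ∧ A ⊆ T ∧ N.Finite ∧ N ⊆ M ∧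
      ∀ (R : Subring L) (B : Subalgebra R L) (I : Ideal R), A ⊆ B → N ⊆ R.subtype '' I →
        f ∈ I • B.toSubmodule := by
  induction hf using Submodule.span_induction with
  | mem x hx =>
    refine ⟨∅, {x}, by simp, by simp, by simp, by simpa, fun R B I _ hN ↦ ?_⟩
    obtain ⟨r, hr, rfl⟩ := hN rfl
    rw [show R.subtype r = r • (1 : L) by simp [Subring.smul_def]]
    exact Submodule.smul_mem_smul hr B.one_mem
  | zero => exact ⟨∅, ∅, by simp, by simp, by simp, by simp, fun R B I _ _ ↦ zero_mem _⟩
  | add x y _ _ hx hy =>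
    obtain ⟨A, N, hA, hAT, hN, hNM, h⟩ := hx
    obtain ⟨A', N', hA', hAT', hN', hNM', h'⟩ := hy
    refine ⟨A ∪ A', N ∪ N', hA.union hA', Set.union_subset hAT hAT', hN.union hN',
      Set.union_subset hNM hNM', fun R B I hA hN ↦ ?_⟩
    rw [Set.union_subset_iff] at hA hN
    exact add_mem (h R B I hA.1 hN.1) (h' R B I hA.2 hN.2)
  | smul a x _ hx =>
    obtain ⟨A, N, hA, hAT, hN, hNM, h⟩ := hx
    refine ⟨insert a.1 A, N, hA.insert _, Set.insert_subset a.2 hAT, hN, hNM, fun R B I hA hN ↦ ?_⟩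
    rw [Set.insert_subset_iff] at hA
    rw [Subring.smul_def, smul_eq_mul, mul_comm]
    exact B.mul_mem_smul (h R B I hA.2 hN) hA.1

/-- Idempotents modulo the Jacobson radical on the two charts of a projective line which agree on
the overlap can be corrected to functions which glue. -/
theorem exists_sub_eq_add_of_idempotent (S : Subring L) (m : Ideal S)
    (hm : ∀ r ∈ m, IsUnit (1 - r)) {t : L} (ht : t ≠ 0) {f₀ f₁ : L}
    (hf₀ : f₀ ∈ intClosure (S ∪ {t})) (hf₁ : f₁ ∈ intClosure (S ∪ {t⁻¹}))
    (e₀ : f₀ ^ 2 - f₀ ∈ Submodule.span (intClosure (S ∪ {t} : Set L)) (S.subtype '' m))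
    (e₁ : f₁ ^ 2 - f₁ ∈ Submodule.span (intClosure (S ∪ {t⁻¹} : Set L)) (S.subtype '' m))
    (e₂ : f₀ - f₁ ∈ Submodule.span (intClosure (S ∪ {t, t⁻¹} : Set L)) (S.subtype '' m)) :
    ∃ g₀ ∈ Submodule.span (intClosure (S ∪ {t} : Set L)) (S.subtype '' m),
    ∃ g₁ ∈ Submodule.span (intClosure (S ∪ {t⁻¹} : Set L)) (S.subtype '' m),
      f₀ - f₁ = g₀ + g₁ := by
  obtain ⟨A₀, N₀, hA₀, hAT₀, hN₀, hNM₀, k₀⟩ := exists_finite_of_mem_span e₀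
  obtain ⟨A₁, N₁, hA₁, hAT₁, hN₁, hNM₁, k₁⟩ := exists_finite_of_mem_span e₁
  obtain ⟨A₂, N₂, hA₂, hAT₂, hN₂, hNM₂, k₂⟩ := exists_finite_of_mem_span e₂
  have hle₀ : intClosure (S ∪ {t} : Set L) ≤ intClosure (S ∪ {t, t⁻¹}) :=
    intClosure_mono (Set.union_subset_union_right _ (by simp))
  have hle₁ : intClosure (S ∪ {t⁻¹} : Set L) ≤ intClosure (S ∪ {t, t⁻¹}) :=
    intClosure_mono (Set.union_subset_union_right _ (by simp))
  -- descend to a finitely generated subring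
  obtain ⟨s₀, hs₀, hsC₀, hX₀⟩ := exists_finite_of_subset_intClosure (hA₀.insert f₀)
    (Set.insert_subset hf₀ hAT₀)
  obtain ⟨s₁, hs₁, hsC₁, hX₁⟩ := exists_finite_of_subset_intClosure (hA₁.insert f₁)
    (Set.insert_subset hf₁ hAT₁)
  obtain ⟨s₂, hs₂, hsC₂, hX₂⟩ := exists_finite_of_subset_intClosure hA₂ hAT₂
  set s := ((s₀ ∪ s₁ ∪ s₂) ∩ S) ∪ (N₀ ∪ N₁ ∪ N₂) with hs
  have hNM : N₀ ∪ N₁ ∪ N₂ ⊆ S.subtype '' m := by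
    simp only [Set.union_subset_iff]; exact ⟨⟨hNM₀, hNM₁⟩, hNM₂⟩
  have hmS : S.subtype '' m ⊆ S := by rintro _ ⟨x, -, rfl⟩; exact x.2
  have hsfin : s.Finite := by
    refine Set.Finite.union (Set.Finite.inter_of_left ?_ _) ?_
    · exact (hs₀.union hs₁).union hs₂
    · exact (hN₀.union hN₁).union hN₂
  let R : Subring L := closure s
  have hsS : s ⊆ S := Set.union_subset Set.inter_subset_right (hNM.trans hmS)
  have hRS : R ≤ S := closure_le.mpr hsS
  have hsR : s ⊆ R := subset_closure
  have hs₀' : s₀ ⊆ R ∪ {t} := fun x hx ↦ (hsC₀ hx).imp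
    (fun h ↦ hsR (.inl ⟨.inl (.inl hx), h⟩)) id
  have hs₁' : s₁ ⊆ R ∪ {t⁻¹} := fun x hx ↦ (hsC₁ hx).imp
    (fun h ↦ hsR (.inl ⟨.inl (.inr hx), h⟩)) id
  have hs₂' : s₂ ⊆ R ∪ {t, t⁻¹} := fun x hx ↦ (hsC₂ hx).imp
    (fun h ↦ hsR (.inl ⟨.inr hx, h⟩)) id
  replace hX₀ := hX₀.trans (intClosure_mono hs₀')
  replace hX₁ := hX₁.trans (intClosure_mono hs₁')
  replace hX₂ := hX₂.trans (intClosure_mono hs₂')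
  have hle₀' : intClosure (R ∪ {t} : Set L) ≤ intClosure (R ∪ {t, t⁻¹}) :=
    intClosure_mono (Set.union_subset_union_right _ (by simp))
  have hle₁' : intClosure (R ∪ {t⁻¹} : Set L) ≤ intClosure (R ∪ {t, t⁻¹}) :=
    intClosure_mono (Set.union_subset_union_right _ (by simp))
  have hnoeth : IsNoetherianRing R := by
    have h1 : Algebra.FiniteType ℤ (Algebra.adjoin ℤ s) :=
      (Subalgebra.fg_iff_finiteType _).mp (Subalgebra.fg_def.mpr ⟨s, hsfin, rfl⟩)
    have h2 : IsNoetherianRing (Algebra.adjoin ℤ s) := Algebra.FiniteType.isNoetherianRing ℤ _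
    have h3 : (Algebra.adjoin ℤ s).toSubring = R := by
      rw [Algebra.adjoin_eq_ring_closure]
      refine le_antisymm (closure_le.mpr (Set.union_subset ?_ subset_closure))
        (closure_mono Set.subset_union_right)
      rintro _ ⟨n, rfl⟩
      exact intCast_mem _ n
    rw [← h3]
    exact h2
  set X := insert f₀ A₀ ∪ insert f₁ A₁ ∪ A₂ with hX
  have hXfin : X.Finite := ((hA₀.insert _).union (hA₁.insert _)).union hA₂
  have hXint : X ⊆ intClosure (R ∪ {t, t⁻¹}) :=
    Set.union_subset (Set.union_subset (hX₀.trans hle₀') (hX₁.trans hle₁')) hX₂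
  let B := Algebra.adjoin R ({t, t⁻¹} ∪ X)
  let T₀ : Subalgebra R L := { intClosure (R ∪ {t}) with
    algebraMap_mem' r := subset_intClosure _ (.inl r.2) }
  let T₁ : Subalgebra R L := { intClosure (R ∪ {t⁻¹}) with
    algebraMap_mem' r := subset_intClosure _ (.inl r.2) }
  obtain ⟨F, hF, hBF⟩ := exists_fg_le_sup_inf ht hXfin hXint T₀ T₁ B subset_rfl subset_rfl rfl
  have hXB : X ⊆ B := Set.subset_union_right.trans Algebra.subset_adjoin
  let I : Ideal R := m.comap (Subring.inclusion hRS)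
  have hNI : N₀ ∪ N₁ ∪ N₂ ⊆ R.subtype '' I := by
    intro x hx
    refine ⟨⟨x, hsR (.inr hx)⟩, ?_, rfl⟩
    obtain ⟨y, hy, rfl⟩ := hNM hx
    exact hy
  have hAX₀ : insert f₀ A₀ ⊆ (B ⊓ T₀ : Subalgebra R L) := fun x hx ↦
    ⟨hXB (.inl (.inl hx)), hX₀ hx⟩
  have hAX₁ : insert f₁ A₁ ⊆ (B ⊓ T₁ : Subalgebra R L) := fun x hx ↦
    ⟨hXB (.inl (.inr hx)), hX₁ hx⟩
  obtain ⟨r, hr, hrf⟩ := Subalgebra.exists_one_sub_smul_mem_of_sup_eq (B ⊓ T₀) (B ⊓ T₁) B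
    inf_le_left inf_le_left F hF hBF I (hAX₀ (.inl rfl)) (hAX₁ (.inl rfl))
    (k₀ R _ I ((Set.subset_insert _ _).trans hAX₀)
      ((Set.subset_union_left.trans Set.subset_union_left).trans hNI))
    (k₁ R _ I ((Set.subset_insert _ _).trans hAX₁)
      ((Set.subset_union_right.trans Set.subset_union_left).trans hNI))
    (k₂ R _ I (Set.subset_union_right.trans hXB) (Set.subset_union_right.trans hNI))
  have hspan (T : Subring L) (B' : Subalgebra R L) (h : (B' : Set L) ⊆ T) {x : L}
      (hx : x ∈ I • B'.toSubmodule) : x ∈ Submodule.span T (S.subtype '' m) := by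
    induction hx using Submodule.smul_induction_on' with
    | smul r hr n hn =>
      rw [Subring.smul_def, smul_eq_mul, mul_comm]
      exact Submodule.smul_mem _ (⟨n, h hn⟩ : T) (Submodule.subset_span ⟨_, hr, rfl⟩)
    | add x _ y _ hx hy => exact add_mem hx hy
  obtain ⟨g₀, hg₀, g₁, hg₁, hg⟩ := Submodule.mem_sup.mp hrf
  obtain ⟨v, hv⟩ := (hm _ hr).exists_left_inv
  have hv' : (v : L) * (1 - r) = 1 := by simpa using congr_arg Subtype.val hv
  refine ⟨v * g₀, ?_, v * g₁, ?_, ?_⟩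
  · exact Submodule.smul_mem _ (⟨v, subset_intClosure _ (.inl v.2)⟩ : intClosure (S ∪ {t} : Set L))
      (hspan _ (B ⊓ T₀) (fun x hx ↦ intClosure_mono (Set.union_subset_union_left _ hRS) hx.2) hg₀)
  · exact Submodule.smul_mem _
      (⟨v, subset_intClosure _ (.inl v.2)⟩ : intClosure (S ∪ {t⁻¹} : Set L))
      (hspan _ (B ⊓ T₁) (fun x hx ↦ intClosure_mono (Set.union_subset_union_left _ hRS) hx.2) hg₁)
  · rw [← mul_add, hg, Subring.smul_def, smul_eq_mul, ← mul_assoc]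
    change _ = (v : L) * (1 - r) * _
    rw [hv', one_mul]

end Subring

end

section

open IsLocalRing Filter

namespace ValuationSubring

variable {L : Type*} [Field L]

lemma mul_mem_nonunits (V : ValuationSubring L) {x y : L} (hx : x ∈ V) (hy : y ∈ V.nonunits) :
    x * y ∈ V.nonunits := by
  rw [mem_nonunits_iff] at hy ⊢
  rw [map_mul]
  exact (mul_le_of_le_one_left' ((V.valuation_le_one_iff _).mpr hx)).trans_lt hy

lemma one_notMem_nonunits (V : ValuationSubring L) : (1 : L) ∉ V.nonunits := by
  simp [mem_nonunits_iff]

instance isIntegrallyClosedIn_toSubring (V : ValuationSubring L) :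
    IsIntegrallyClosedIn V.toSubring L :=
  have : IsFractionRing V.toSubring L := inferInstanceAs (IsFractionRing V L)
  (isIntegrallyClosed_iff_isIntegrallyClosedIn L).mp inferInstance

lemma le_toLocalSubring_iff {S : LocalSubring L} {V : ValuationSubring L} :
    S ≤ V.toLocalSubring ↔ S.toSubring ≤ V.toSubring ∧
      ∀ x ∈ maximalIdeal S.toSubring, (x : L) ∈ V.nonunits := by
  constructor
  · rintro ⟨h, hl⟩
    refine ⟨h, fun x hx ↦ ?_⟩
    rw [mem_nonunits_iff_exists_mem_maximalIdeal]
    refine ⟨h x.2, ?_⟩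
    rw [mem_maximalIdeal, _root_.mem_nonunits_iff] at hx ⊢
    exact fun hu ↦ hx (hl.1 _ hu)
  · rintro ⟨h, hl⟩
    refine ⟨h, ⟨fun x hx ↦ ?_⟩⟩
    by_contra hx'
    have := hl x hx'
    rw [mem_nonunits_iff_exists_mem_maximalIdeal] at this
    exact this.2 hx

/-- The limit of a family of valuation rings along an ultrafilter. -/
def ultralimit {J : Type*} (U : Ultrafilter J) (V : J → ValuationSubring L) :
    ValuationSubring L where
  carrier := {x | ∀ᶠ j in U, x ∈ V j}
  zero_mem' := .of_forall fun j ↦ zero_mem (V j)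
  one_mem' := .of_forall fun j ↦ one_mem (V j)
  add_mem' hx hy := by filter_upwards [hx, hy] with j hx hy using (V j).add_mem _ _ hx hy
  mul_mem' hx hy := by filter_upwards [hx, hy] with j hx hy using (V j).mul_mem _ _ hx hy
  neg_mem' hx := by filter_upwards [hx] with j hx using (V j).neg_mem _ hx
  mem_or_inv_mem' x := Ultrafilter.eventually_or.mp (.of_forall fun j ↦ (V j).mem_or_inv_mem x)

lemma mem_ultralimit {J : Type*} {U : Ultrafilter J} {V : J → ValuationSubring L} {x : L} :
    x ∈ ultralimit U V ↔ ∀ᶠ j in U, x ∈ V j := Iff.rfl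

lemma mem_nonunits_ultralimit {J : Type*} {U : Ultrafilter J} {V : J → ValuationSubring L}
    {x : L} : x ∈ (ultralimit U V).nonunits ↔ ∀ᶠ j in U, x ∈ (V j).nonunits := by
  simp only [mem_nonunits_iff_or, mem_ultralimit, Ultrafilter.eventually_or,
    Ultrafilter.eventually_not, eventually_const]

lemma le_ultralimit {J : Type*} {U : Ultrafilter J} {V : J → ValuationSubring L}
    {S : LocalSubring L} (h : ∀ᶠ j in U, S ≤ (V j).toLocalSubring) :
    S ≤ (ultralimit U V).toLocalSubring := by
  simp only [le_toLocalSubring_iff] at h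
  refine le_toLocalSubring_iff.mpr ⟨fun x hx ↦ ?_, fun x hx ↦ mem_nonunits_ultralimit.mpr ?_⟩
  · exact h.mono fun j h ↦ h.1 hx
  · exact h.mono fun j h ↦ h.2 x hx

end ValuationSubring

namespace LocalSubring

variable {L : Type*} [Field L]

lemma mem_ofPrime {A : Subring L} {M : Ideal A} [M.IsPrime] {x : L}
    (hx : x ∈ (ofPrime A M).toSubring) : ∃ a b : A, b ∉ M ∧ x * b = a := by
  obtain ⟨⟨a, b⟩, h⟩ := IsLocalization.surj M.primeCompl (⟨x, hx⟩ : (ofPrime A M).toSubring)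
  exact ⟨a, b, b.2, congr_arg Subtype.val h⟩

lemma le_ofPrime_of_le {S : LocalSubring L} {A : Subring L} (h : S.toSubring ≤ A) {M : Ideal A}
    [M.IsPrime] (hM : ∀ x ∈ maximalIdeal S.toSubring, Subring.inclusion h x ∈ M) :
    S ≤ ofPrime A M := by
  refine ⟨h.trans (le_ofPrime ..), ((local_hom_TFAE _).out 2 0).mp ?_⟩
  conv_rhs => rw [← IsLocalization.AtPrime.map_eq_maximalIdeal M]
  rw [Ideal.map_le_iff_le_comap]
  intro x hx
  exact Ideal.mem_map_of_mem (algebraMap A (ofPrime A M).toSubring) (hM x hx)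

lemma coe_mem_maximalIdeal_ofPrime {A : Subring L} {M : Ideal A} [M.IsPrime] {a : A} :
    Subring.inclusion (le_ofPrime A M) a ∈ maximalIdeal (ofPrime A M).toSubring ↔ a ∈ M :=
  IsLocalization.AtPrime.to_map_mem_maximal_iff _ M a

lemma ofPrime_le_toLocalSubring {A : Subring L} {M : Ideal A} [M.IsPrime]
    {V : ValuationSubring L} (h : A ≤ V.toSubring)
    (hM : ∀ a : A, a ∈ M ↔ (a : L) ∈ V.nonunits) : ofPrime A M ≤ V.toLocalSubring := by
  have key {x : L} {a b : A} (hb : b ∉ M) (h : x * b = a) : x = (b : L)⁻¹ * a ∧ (b : L)⁻¹ ∈ V := by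
    rw [hM, V.mem_nonunits_iff_or, not_or, not_not] at hb
    refine ⟨?_, hb.2⟩
    rw [← h]
    field_simp [hb.1]
  refine ValuationSubring.le_toLocalSubring_iff.mpr ⟨fun x hx ↦ ?_, fun ⟨x, hx⟩ hxm ↦ ?_⟩
  · obtain ⟨a, b, hb, hab⟩ := mem_ofPrime hx
    rw [(key hb hab).1]
    exact mul_mem (key hb hab).2 (h a.2)
  · obtain ⟨a, b, hb, hab⟩ := mem_ofPrime hx
    change x ∈ _
    rw [(key hb hab).1]
    refine V.mul_mem_nonunits (key hb hab).2 ?_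
    rw [← hM, ← coe_mem_maximalIdeal_ofPrime]
    convert Ideal.mul_mem_right (Subring.inclusion (le_ofPrime A M) b) _ hxm using 1
    exact Subtype.ext hab.symm

instance isIntegrallyClosedIn_ofPrime (A : Subring L) [IsIntegrallyClosedIn A L] (M : Ideal A)
    [M.IsPrime] : IsIntegrallyClosedIn (ofPrime A M).toSubring L := by
  refine isIntegrallyClosedIn_iff.mpr ⟨Subtype.val_injective, fun {x} hx ↦ ?_⟩
  obtain ⟨⟨b, hb⟩, h⟩ := hx.exists_multiple_integral_of_isLocalization M.primeCompl x
  obtain ⟨a, ha⟩ := IsIntegrallyClosedIn.isIntegral_iff.mp h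
  have hb0 : (b : L) ≠ 0 := fun h ↦ hb (by
    rw [show b = 0 from Subtype.ext h]; exact zero_mem _)
  obtain ⟨c, hc⟩ := (IsLocalization.map_units (ofPrime A M).toSubring
    (⟨b, hb⟩ : M.primeCompl)).exists_right_inv
  refine ⟨c * Subring.inclusion (le_ofPrime A M) a, ?_⟩
  have hc' : (b : L) * c = 1 := congr_arg Subtype.val hc
  change (c : L) * a = x
  replace ha : (a : L) = b * x := ha
  rw [ha, ← mul_assoc, mul_comm (c : L), hc', one_mul]

end LocalSubring

namespace ValuationSubring

variable {L : Type u} [Field L]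

/-- If the centre of `V` on `T` is contained in a maximal ideal `M`, then some valuation ring
contained in `V` has centre `M`. -/
lemma exists_le_of_center_le (V : ValuationSubring L) {T : Subring L} (hT : T ≤ V.toSubring)
    {M : Ideal T} (hM : M ≠ ⊤) (h : ∀ x : T, (x : L) ∈ V.nonunits → x ∈ M) :
    ∃ V' ≤ V, T ≤ V'.toSubring ∧ ∀ x ∈ M, (x : L) ∈ V'.nonunits := by
  let C : Subring L :=
    { carrier := {x | ∃ y ∈ T, x - y ∈ V.nonunits}
      zero_mem' := ⟨0, T.zero_mem, by simp⟩
      one_mem' := ⟨1, T.one_mem, by simp⟩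
      add_mem' := by
        rintro a b ⟨y, hy, hay⟩ ⟨z, hz, hbz⟩
        exact ⟨y + z, T.add_mem hy hz, by rw [add_sub_add_comm]; exact V.nonunits.add_mem hay hbz⟩
      mul_mem' := by
        rintro a b ⟨y, hy, hay⟩ ⟨z, hz, hbz⟩
        refine ⟨y * z, T.mul_mem hy hz, ?_⟩
        have hb : b ∈ V := by
          simpa using V.add_mem _ _ (nonunits_subset hbz) (hT hz)
        rw [show a * b - y * z = b * (a - y) + y * (b - z) by ring]
        exact V.nonunits.add_mem (V.mul_mem_nonunits hb hay) (V.mul_mem_nonunits (hT hy) hbz)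
      neg_mem' := by
        rintro a ⟨y, hy, hay⟩
        exact ⟨-y, T.neg_mem hy, by rw [← neg_sub']; exact V.nonunits.neg_mem hay⟩ }
  have hCV {x : L} (hx : x ∈ C) : x ∈ V := by
    obtain ⟨y, hy, hxy⟩ := hx
    simpa using V.add_mem _ _ (nonunits_subset hxy) (hT hy)
  let I : Ideal C :=
    { carrier := {x | ∃ y ∈ M, (x : L) - y ∈ V.nonunits}
      zero_mem' := ⟨0, M.zero_mem, by simp⟩
      add_mem' := by
        rintro a b ⟨y, hy, hay⟩ ⟨z, hz, hbz⟩
        refine ⟨y + z, M.add_mem hy hz, ?_⟩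
        push_cast
        rw [add_sub_add_comm]; exact V.nonunits.add_mem hay hbz
      smul_mem' := by
        rintro ⟨c, hc⟩ b ⟨z, hz, hbz⟩
        obtain ⟨y, hy, hcy⟩ := id hc
        refine ⟨⟨y, hy⟩ * z, M.mul_mem_left _ hz, ?_⟩
        change c * b - y * z ∈ _
        rw [show c * b - y * z = c * (b - z) + z * (c - y) by ring]
        exact V.nonunits.add_mem (V.mul_mem_nonunits (hCV hc) hbz)
          (V.mul_mem_nonunits (hT z.2) hcy) }
  have hI : I ≠ ⊤ := by
    rw [Ne, Ideal.eq_top_iff_one]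
    rintro ⟨y, hy, h1⟩
    have := M.add_mem (h (1 - y) h1) hy
    rw [sub_add_cancel] at this
    exact hM ((Ideal.eq_top_iff_one _).mpr this)
  obtain ⟨V', hCV', hV'⟩ := Ideal.image_subset_nonunits_valuationSubring I hI
  have hVn : ∀ x ∈ V.nonunits, x ∈ V'.nonunits := fun x hx ↦
    hV' ⟨⟨x, 0, T.zero_mem, by simpa using hx⟩, ⟨0, M.zero_mem, by simpa using hx⟩, rfl⟩
  refine ⟨V', nonunits_le_nonunits.mp hVn, ?_, fun x hx ↦ ?_⟩
  · exact fun x hx ↦ hCV' ⟨x, hx, by simp⟩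
  · exact hV' ⟨⟨x, x, x.2, by simp⟩, ⟨x, hx, by simp⟩, rfl⟩

/-- A class of valuation rings dominating `D` which is closed in the sense of Riemann–Zariski
spaces. -/
structure IsClosedClass (D : LocalSubring L) (P : ValuationSubring L → Prop) : Prop where
  le {V} : P V → D ≤ V.toLocalSubring
  mono {V V'} : V' ≤ V → D ≤ V'.toLocalSubring → P V → P V'
  ultralimit {J : Type u} (U : Ultrafilter J) (V : J → ValuationSubring L) :
    (∀ j, P (V j)) → P (ultralimit U V)

/-- A maximal ideal containing all functions vanishing along the class `P` is the centre of a
member of `P`. -/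
lemma IsClosedClass.exists_center {D : LocalSubring L} {P : ValuationSubring L → Prop}
    (hP : IsClosedClass D P) {S : LocalSubring L} (hDS : D ≤ S) {T : Subring L}
    (hST : S.toSubring ≤ T) {M : Ideal T} [hM : M.IsPrime]
    (h : ∀ f : T, (∀ V, S ≤ V.toLocalSubring → T ≤ V.toSubring → P V → (f : L) ∈ V.nonunits) →
      f ∈ M) :
    ∃ V, S ≤ V.toLocalSubring ∧ P V ∧ T ≤ V.toSubring ∧ ∀ x ∈ M, (x : L) ∈ V.nonunits := by
  let J := {g : T // g ∉ M}
  have hmS (x) (hx : x ∈ maximalIdeal S.toSubring) : Subring.inclusion hST x ∈ M :=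
    h _ fun V hSV _ _ ↦ (le_toLocalSubring_iff.mp hSV).2 x hx
  have key (g : J) : ∃ V, S ≤ V.toLocalSubring ∧ T ≤ V.toSubring ∧ P V ∧
      (g.1 : L) ∉ V.nonunits := by
    by_contra! H
    exact g.2 (h g.1 fun V h₁ h₂ h₃ ↦ H V h₁ h₂ h₃)
  choose V hSV hTV hPV hgV using key
  let F (g : J) : Filter J := 𝓟 {x | g.1 ∣ x.1}
  have : Nonempty J := ⟨1, fun h ↦ hM.ne_top ((Ideal.eq_top_iff_one _).mpr h)⟩
  have : (⨅ g, F g).NeBot := by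
    refine iInf_neBot_of_directed ?_ fun g ↦ principal_neBot_iff.mpr ⟨g, dvd_rfl⟩
    intro a b
    refine ⟨⟨a.1 * b.1, fun h ↦ (hM.mem_or_mem h).elim a.2 b.2⟩, ?_, ?_⟩
    · exact principal_mono.mpr fun x hx ↦ (dvd_mul_right _ _).trans hx
    · exact principal_mono.mpr fun x hx ↦ (dvd_mul_left _ _).trans hx
  let U : Ultrafilter J := .of (⨅ g, F g)
  have hU : (U : Filter J) ≤ ⨅ g, F g := Ultrafilter.of_le _
  have hTl : T ≤ (ValuationSubring.ultralimit U V).toSubring := fun x hx ↦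
    mem_ultralimit.mpr (.of_forall fun j ↦ hTV j hx)
  obtain ⟨V', hV', hTV', hMV'⟩ := exists_le_of_center_le (ValuationSubring.ultralimit U V)
    hTl hM.ne_top (fun x hx ↦ by
      by_contra hxM
      have h₁ : ∀ᶠ j : J in U, x ∣ j.1 := hU (mem_iInf_of_mem ⟨x, hxM⟩ (mem_principal_self _))
      obtain ⟨j, ⟨c, hc⟩, hj⟩ := (h₁.and (mem_nonunits_ultralimit.mp hx)).exists
      refine hgV j ?_
      rw [hc]
      push_cast
      rw [mul_comm]
      exact mul_mem_nonunits _ (hTV j c.2) hj)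
  have hSV' : S ≤ V'.toLocalSubring := le_toLocalSubring_iff.mpr
    ⟨hST.trans hTV', fun x hx ↦ hMV' _ (hmS x hx)⟩
  exact ⟨V', hSV', hP.mono hV' (hDS.trans hSV') (hP.ultralimit U V hPV), hTV', hMV'⟩

/-- An element which is topologically nilpotent for all valuation rings dominating `S` lies in the
radical of the ideal generated by the maximal ideal of `S`. -/
lemma mem_radical_of_forall_mem_nonunits {S : LocalSubring L} {T : Subring L}
    (hST : S.toSubring ≤ T) {f : T}
    (h : ∀ V : ValuationSubring L, S ≤ V.toLocalSubring → T ≤ V.toSubring →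
      (f : L) ∈ V.nonunits) :
    f ∈ ((maximalIdeal S.toSubring).map (Subring.inclusion hST)).radical := by
  rw [Ideal.radical_eq_sInf, Ideal.mem_sInf]
  rintro p ⟨hp, hp'⟩
  obtain ⟨V, hV⟩ := (LocalSubring.ofPrime T p).exists_le_valuationSubring
  have hSV : S ≤ V.toLocalSubring := (LocalSubring.le_ofPrime_of_le hST fun x hx ↦
    hp (Ideal.mem_map_of_mem _ hx)).trans hV
  have hf := h V hSV ((LocalSubring.le_ofPrime T p).trans hV.1)
  rw [← LocalSubring.coe_mem_maximalIdeal_ofPrime]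
  by_contra hf'
  rw [mem_maximalIdeal, _root_.mem_nonunits_iff, not_not] at hf'
  obtain ⟨c, hc⟩ := hf'.exists_left_inv
  have hc' : (c : L) * f = 1 := congr_arg Subtype.val hc
  exact V.one_notMem_nonunits (hc' ▸ V.mul_mem_nonunits (hV.1 c.2) hf)

lemma coe_mem_span_iff {S T : Subring L} (hST : S ≤ T) (m : Ideal S) (x : T) :
    (x : L) ∈ Submodule.span T (S.subtype '' m) ↔ x ∈ m.map (Subring.inclusion hST) := by
  have : Submodule.span T (S.subtype '' m) =
      Submodule.map (Algebra.linearMap T L) (m.map (Subring.inclusion hST)) := by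
    rw [Ideal.map, Ideal.span, Submodule.map_span, ← Set.image_comp]
    rfl
  rw [this, Submodule.mem_map]
  exact ⟨fun ⟨y, hy, e⟩ ↦ Subtype.ext e ▸ hy, fun h ↦ ⟨x, h, rfl⟩⟩

end ValuationSubring

namespace LocalSubring

variable {L : Type*} [Field L]

/-- The union of a chain of local subrings ordered by domination. -/
lemma exists_isUnion_of_isChain {c : Set (LocalSubring L)} (H : IsChain (· ≤ ·) c)
    (hc : c.Nonempty) : ∃ S : LocalSubring L, (∀ A ∈ c, A ≤ S) ∧
      ∀ x ∈ S.toSubring, ∃ A ∈ c, x ∈ A.toSubring := by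
  have inst : Nonempty c := hc.to_subtype
  have hdir := H.directed.mono_comp _ LocalSubring.toSubring_mono
  refine ⟨@LocalSubring.mk _ _ (⨆ i : c, i.1.toSubring) ⟨?_⟩, ?_, ?_⟩
  · intro ⟨a, ha⟩ ⟨b, hb⟩ e
    obtain ⟨A, haA : a ∈ A.1.toSubring⟩ := (Subring.mem_iSup_of_directed hdir).mp ha
    obtain ⟨B, hbB : b ∈ B.1.toSubring⟩ := (Subring.mem_iSup_of_directed hdir).mp hb
    obtain ⟨C, hCA, hCB⟩ := hdir A B
    refine (C.1.2.2 (a := ⟨a, hCA haA⟩) (b := ⟨b, hCB hbB⟩) (Subtype.ext congr(($e).1))).imp ?_ ?_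
    · exact fun h ↦ h.map (Subring.inclusion (le_iSup (fun i : c ↦ i.1.toSubring) C))
    · exact fun h ↦ h.map (Subring.inclusion (le_iSup (fun i : c ↦ i.1.toSubring) C))
  · intro A hA
    refine ⟨le_iSup (fun i : c ↦ i.1.toSubring) ⟨A, hA⟩, ⟨?_⟩⟩
    rintro ⟨a, haA⟩ h
    obtain ⟨⟨b, hb⟩, e⟩ := isUnit_iff_exists_inv.mp h
    obtain ⟨B, hbB : b ∈ B.1.toSubring⟩ := (Subring.mem_iSup_of_directed hdir).mp hb
    obtain ⟨C, hCA, hCB⟩ := H.directed ⟨A, hA⟩ B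
    exact hCA.2.1 ⟨a, haA⟩ (isUnit_iff_exists_inv.mpr ⟨⟨b, hCB.1 hbB⟩, Subtype.ext congr(($e).1)⟩)
  · intro x hx
    obtain ⟨A, hA⟩ := (Subring.mem_iSup_of_directed hdir).mp hx
    exact ⟨A, A.2, hA⟩

lemma isIntegrallyClosedIn_of_isUnion {c : Set (LocalSubring L)} (H : IsChain (· ≤ ·) c)
    (hc : c.Nonempty) (h : ∀ A ∈ c, IsIntegrallyClosedIn A.toSubring L) {S : LocalSubring L}
    (hS : ∀ A ∈ c, A ≤ S) (hS' : ∀ x ∈ S.toSubring, ∃ A ∈ c, x ∈ A.toSubring) :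
    IsIntegrallyClosedIn S.toSubring L := by
  refine isIntegrallyClosedIn_iff.mpr ⟨Subtype.val_injective, fun {x} hx ↦ ?_⟩
  have hx' : x ∈ Subring.intClosure (S.toSubring : Set L) := by
    rw [Subring.mem_intClosure, Subring.closure_eq]; exact hx
  obtain ⟨s, hs, hsC, hxs⟩ := Subring.exists_finite_of_mem_intClosure hx'
  have : ∃ A ∈ c, s ⊆ A.toSubring := by
    clear hxs
    induction s, hs using Set.Finite.induction_on with
    | empty => exact ⟨hc.some, hc.some_mem, by simp⟩
    | @insert a s _ _ ih =>
      rw [Set.insert_subset_iff] at hsC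
      obtain ⟨A, hA, hsA⟩ := ih hsC.2
      obtain ⟨B, hB, haB⟩ := hS' a hsC.1
      obtain hAB | hAB := H.total hA hB
      · exact ⟨B, hB, Set.insert_subset haB (hsA.trans hAB.1)⟩
      · exact ⟨A, hA, Set.insert_subset (hAB.1 haB) hsA⟩
  obtain ⟨A, hA, hsA⟩ := this
  have := h A hA
  exact ⟨⟨x, (hS A hA).1 (Subring.intClosure_le hsA hxs)⟩, rfl⟩

end LocalSubring

namespace ValuationSubring

variable {L : Type u} [Field L] {D : LocalSubring L} {P Q : ValuationSubring L → Prop}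

/-- The class `P` has a member dominating `S`. -/
def Meets (P : ValuationSubring L → Prop) (S : LocalSubring L) : Prop :=
  ∃ V : ValuationSubring L, S ≤ V.toLocalSubring ∧ P V

lemma IsClosedClass.meets_of_isUnion (hP : IsClosedClass D P) {c : Set (LocalSubring L)}
    (H : IsChain (· ≤ ·) c) (hc : c.Nonempty) (h : ∀ A ∈ c, Meets P A) {S : LocalSubring L}
    (hS : ∀ A ∈ c, A ≤ S) (hS' : ∀ x ∈ S.toSubring, ∃ A ∈ c, x ∈ A.toSubring) :
    Meets P S := by
  choose V hV hPV using fun j : c ↦ h j j.2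
  have : Nonempty c := hc.to_subtype
  have : IsDirectedOrder c := ⟨H.directed⟩
  let U : Ultrafilter c := .of atTop
  have hU : (U : Filter c) ≤ atTop := Ultrafilter.of_le _
  have key (A) (hA : A ∈ c) : A ≤ (ValuationSubring.ultralimit U V).toLocalSubring := by
    refine le_ultralimit (hU ?_)
    filter_upwards [eventually_ge_atTop ⟨A, hA⟩] with j hj using le_trans hj (hV j)
  refine ⟨ValuationSubring.ultralimit U V, le_toLocalSubring_iff.mpr ⟨fun x hx ↦ ?_, fun x hx ↦ ?_⟩,
    hP.ultralimit U V hPV⟩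
  · obtain ⟨A, hA, hxA⟩ := hS' x hx
    exact (key A hA).1 hxA
  · obtain ⟨A, hA, hxA⟩ := hS' x x.2
    refine (le_toLocalSubring_iff.mp (key A hA)).2 ⟨x, hxA⟩ fun hu ↦ hx ?_
    exact hu.map (Subring.inclusion (hS A hA).1)

/-- If `S` is maximal among integrally closed local subrings meeting both `P` and `Q`, then on
charts not contained in `S`, the loci `P` and `Q` are separated by an idempotent. -/
lemma exists_idempotent_of_maximal (hP : IsClosedClass D P) (hQ : IsClosedClass D Q)
    (hPQ : ∀ V : ValuationSubring L, D ≤ V.toLocalSubring → P V ∨ Q V)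
    {S : LocalSubring L} (hDS : D ≤ S)
    (hmax : ∀ S' : LocalSubring L, S ≤ S' → IsIntegrallyClosedIn S'.toSubring L →
      Meets P S' → Meets Q S' → S'.toSubring ≤ S.toSubring)
    {t : L} (ht : t ∉ S.toSubring) {T : Subring L}
    (hT : T = Subring.intClosure (S.toSubring ∪ {t})) :
    ∃ f ∈ T, f ^ 2 - f ∈ Submodule.span T (S.toSubring.subtype '' maximalIdeal S.toSubring) ∧
      (∀ V : ValuationSubring L, S ≤ V.toLocalSubring → T ≤ V.toSubring → Q V →
        f ∈ V.nonunits) ∧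
      ∀ V : ValuationSubring L, S ≤ V.toLocalSubring → T ≤ V.toSubring → P V →
        1 - f ∈ V.nonunits := by
  have hST : S.toSubring ≤ T := hT ▸ Set.subset_union_left.trans (Subring.subset_intClosure _)
  have htT : t ∈ T := hT ▸ Subring.subset_intClosure _ (by simp)
  have hTint : IsIntegrallyClosedIn T L := hT ▸ inferInstance
  let K (P : ValuationSubring L → Prop) : Ideal T :=
    { carrier := {f | ∀ V : ValuationSubring L, S ≤ V.toLocalSubring → T ≤ V.toSubring → P V →
        (f : L) ∈ V.nonunits}
      zero_mem' := fun V _ _ _ ↦ V.nonunits.zero_mem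
      add_mem' := fun ha hb V h₁ h₂ h₃ ↦ V.nonunits.add_mem (ha V h₁ h₂ h₃) (hb V h₁ h₂ h₃)
      smul_mem' := fun c x hx V h₁ h₂ h₃ ↦ V.mul_mem_nonunits (h₂ c.2) (hx V h₁ h₂ h₃) }
  have hK : K P ⊔ K Q = ⊤ := by
    by_contra hne
    obtain ⟨M, hM, hle⟩ := Ideal.exists_le_maximal _ hne
    have meets (P') (hP' : IsClosedClass D P') (hle : K P' ≤ M) :
        S ≤ LocalSubring.ofPrime T M ∧ Meets P' (LocalSubring.ofPrime T M) := by
      obtain ⟨V, hSV, hPV, hTV, hMV⟩ := hP'.exists_center hDS hST (M := M)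
        fun f hf ↦ hle (show f ∈ K P' from hf)
      constructor
      · exact LocalSubring.le_ofPrime_of_le hST fun x hx ↦ hle fun V hSV _ _ ↦
          (le_toLocalSubring_iff.mp hSV).2 x hx
      · refine ⟨V, LocalSubring.ofPrime_le_toLocalSubring hTV fun a ↦ ⟨hMV a, fun ha ↦ ?_⟩, hPV⟩
        by_contra haM
        obtain ⟨b, c, hc, e⟩ := hM.exists_inv haM |>.imp fun b h ↦ h
        refine V.one_notMem_nonunits ?_
        have e' : (b : L) * a + c = 1 := congr_arg Subtype.val e
        rw [← e']
        exact V.nonunits.add_mem (V.mul_mem_nonunits (hTV b.2) ha) (hMV c hc)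
    obtain ⟨hS, hSP⟩ := meets P hP (le_sup_left.trans hle)
    have hSQ := (meets Q hQ (le_sup_right.trans hle)).2
    exact ht (hmax _ hS inferInstance hSP hSQ (LocalSubring.le_ofPrime T M htT))
  obtain ⟨a, ha, b, hb, hab⟩ := Submodule.mem_sup.mp
    ((Ideal.eq_top_iff_one _).mp hK)
  have hrad := mem_radical_of_forall_mem_nonunits hST (f := a * b) fun V h₁ h₂ ↦ by
    obtain h | h := hPQ V (hDS.trans h₁)
    · rw [mul_comm]; exact V.mul_mem_nonunits (h₂ b.2) (ha V h₁ h₂ h)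
    · exact V.mul_mem_nonunits (h₂ a.2) (hb V h₁ h₂ h)
  obtain ⟨n, hn⟩ := hrad
  have hcop : IsCoprime (a ^ (n + 1)) (b ^ (n + 1)) := IsCoprime.pow ⟨1, 1, by simpa using hab⟩
  obtain ⟨u, v, huv⟩ := hcop
  have huP : u * a ^ (n + 1) ∈ K P := Ideal.mul_mem_left _ _ (Ideal.pow_mem_of_mem _ ha _ (by simp))
  have hvQ : v * b ^ (n + 1) ∈ K Q := Ideal.mul_mem_left _ _ (Ideal.pow_mem_of_mem _ hb _ (by simp))
  refine ⟨(v * b ^ (n + 1) : T), Subtype.prop _, ?_, fun V h₁ h₂ h₃ ↦ hvQ V h₁ h₂ h₃,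
    fun V h₁ h₂ h₃ ↦ ?_⟩
  · refine (coe_mem_span_iff hST _ ((v * b ^ (n + 1)) ^ 2 - v * b ^ (n + 1))).mpr ?_
    rw [show (v * b ^ (n + 1)) ^ 2 - v * b ^ (n + 1) = (a * b) ^ n * (-(u * v * a * b)) by
      linear_combination (v * b ^ (n + 1)) * huv]
    exact Ideal.mul_mem_right _ _ hn
  · have : (1 : L) - (v * b ^ (n + 1) : T) = (u * a ^ (n + 1) : T) := by
      rw [eq_sub_of_add_eq huv]; rfl
    rw [this]
    exact huP V h₁ h₂ h₃

end ValuationSubring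

namespace ValuationSubring

variable {L : Type u} [Field L] {D : LocalSubring L} {P Q : ValuationSubring L → Prop}

/-- Every valuation ring dominating `D` dominates its integral closure, provided the latter is
local. -/
lemma intClosure_le_toLocalSubring [IsLocalRing (Subring.intClosure (D.toSubring : Set L))]
    {V : ValuationSubring L} (h : D ≤ V.toLocalSubring) :
    LocalSubring.mk (Subring.intClosure (D.toSubring : Set L)) ≤ V.toLocalSubring := by
  have hle : Subring.intClosure (D.toSubring : Set L) ≤ V.toSubring := Subring.intClosure_le h.1
  let A := Subring.closure (D.toSubring : Set L)
  let B := integralClosure A L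
  have hBV : B.toSubring ≤ V.toSubring := hle
  let M : Ideal B := (maximalIdeal V).comap (Subring.inclusion hBV)
  have hMc : (M.comap (algebraMap A B)).IsMaximal := by
    refine Ideal.isMaximal_iff.mpr ⟨fun h ↦ (Ideal.ne_top_iff_one _).mp
      (Ideal.IsPrime.ne_top (I := M.comap (algebraMap A B)) inferInstance) h,
      fun J x hJ hx hxJ ↦ ?_⟩
    have hxD : x.1 ∈ D.toSubring := by
      have : x.1 ∈ Subring.closure (D.toSubring : Set L) := x.2
      rwa [Subring.closure_eq] at this
    have hu : IsUnit (⟨x, hxD⟩ : D.toSubring) := by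
      by_contra hu
      refine hx (?_ : _ ∈ maximalIdeal V)
      rw [← coe_mem_nonunits_iff]
      exact (le_toLocalSubring_iff.mp h).2 ⟨x, hxD⟩ hu
    obtain ⟨c, hc⟩ := hu.exists_left_inv
    have := J.mul_mem_left ⟨c, Subring.subset_closure c.2⟩ hxJ
    rwa [show (⟨c, Subring.subset_closure c.2⟩ : A) * x = 1 from
      Subtype.ext (congr_arg Subtype.val hc :)] at this
  have hMmax : M.IsMaximal := Ideal.isMaximal_of_isIntegral_of_isMaximal_comap M hMc
  refine le_toLocalSubring_iff.mpr ⟨hle, fun x hx ↦ ?_⟩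
  have hxM : x ∈ (M : Ideal (Subring.intClosure (D.toSubring : Set L))) :=
    (eq_maximalIdeal (R := Subring.intClosure (D.toSubring : Set L)) hMmax) ▸ hx
  exact mem_nonunits_iff_exists_mem_maximalIdeal.mpr ⟨hle x.2, hxM⟩

lemma le_intClosure [IsLocalRing (Subring.intClosure (D.toSubring : Set L))] :
    D ≤ LocalSubring.mk (Subring.intClosure (D.toSubring : Set L)) := by
  obtain ⟨V, hV⟩ := D.exists_le_valuationSubring
  refine ⟨Subring.subset_intClosure _, ⟨fun x hx ↦ ?_⟩⟩
  by_contra hx'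
  have := (le_toLocalSubring_iff.mp hV).2 x hx'
  obtain ⟨c, hc⟩ := hx.exists_left_inv
  have hc' : (c : L) * x = 1 := congr_arg Subtype.val hc
  exact V.one_notMem_nonunits (hc' ▸ V.mul_mem_nonunits
    ((intClosure_le_toLocalSubring hV).1 c.2) this)

/-- Connectedness of the space of valuation rings dominating a local ring whose
integral closure is local. -/
theorem forall_or_forall_of_isClosedClass
    [IsLocalRing (Subring.intClosure (D.toSubring : Set L))]
    (hP : IsClosedClass D P) (hQ : IsClosedClass D Q)
    (hPQ : ∀ V : ValuationSubring L, D ≤ V.toLocalSubring → P V ∨ Q V)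
    (hdisj : ∀ V, P V → ¬ Q V) :
    (∀ V : ValuationSubring L, D ≤ V.toLocalSubring → P V) ∨
      ∀ V : ValuationSubring L, D ≤ V.toLocalSubring → Q V := by
  by_contra! ⟨⟨V₁, hDV₁, hV₁⟩, ⟨V₂, hDV₂, hV₂⟩⟩
  replace hV₁ : Q V₁ := (hPQ V₁ hDV₁).resolve_left hV₁
  replace hV₂ : P V₂ := (hPQ V₂ hDV₂).resolve_right hV₂
  let X : Set (LocalSubring L) :=
    {S | D ≤ S ∧ IsIntegrallyClosedIn S.toSubring L ∧ Meets P S ∧ Meets Q S}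
  have hX₀ : LocalSubring.mk (Subring.intClosure (D.toSubring : Set L)) ∈ X :=
    ⟨le_intClosure, inferInstance, ⟨V₂, intClosure_le_toLocalSubring hDV₂, hV₂⟩,
      ⟨V₁, intClosure_le_toLocalSubring hDV₁, hV₁⟩⟩
  obtain ⟨S, -, hS⟩ := zorn_le_nonempty₀ X (fun c hc H y hy ↦ by
    obtain ⟨B, hB, hB'⟩ := LocalSubring.exists_isUnion_of_isChain H ⟨y, hy⟩
    exact ⟨B, ⟨(hc hy).1.trans (hB y hy), LocalSubring.isIntegrallyClosedIn_of_isUnion H ⟨y, hy⟩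
      (fun A hA ↦ (hc hA).2.1) hB hB', hP.meets_of_isUnion H ⟨y, hy⟩ (fun A hA ↦ (hc hA).2.2.1)
      hB hB', hQ.meets_of_isUnion H ⟨y, hy⟩ (fun A hA ↦ (hc hA).2.2.2) hB hB'⟩, hB⟩) _ hX₀
  obtain ⟨hDS, hSint, ⟨VP, hSVP, hVP⟩, ⟨VQ, hSVQ, hVQ⟩⟩ := hS.prop
  have hmax (S' : LocalSubring L) (hSS' : S ≤ S') (h₁ : IsIntegrallyClosedIn S'.toSubring L)
      (h₂ : Meets P S') (h₃ : Meets Q S') : S'.toSubring ≤ S.toSubring :=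
    (hS.le_of_ge ⟨hDS.trans hSS', h₁, h₂, h₃⟩ hSS').1
  -- `S` is not a valuation ring
  obtain ⟨t, ht, ht'⟩ : ∃ t, t ∉ S.toSubring ∧ t⁻¹ ∉ S.toSubring := by
    by_contra! H
    let V : ValuationSubring L := ⟨S.toSubring, fun x ↦ or_iff_not_imp_left.mpr (H x)⟩
    have hV (V' : ValuationSubring L) (h : S ≤ V'.toLocalSubring) : V = V' :=
      toLocalSubring_injective (V.isMax_toLocalSubring.eq_of_le h)
    obtain rfl := hV VP hSVP
    obtain rfl := hV VQ hSVQ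
    exact hdisj _ hVP hVQ
  have ht0 : t ≠ 0 := by rintro rfl; exact ht S.toSubring.zero_mem
  set T₀ := Subring.intClosure (S.toSubring ∪ {t} : Set L) with hT₀
  set T₁ := Subring.intClosure (S.toSubring ∪ {t⁻¹} : Set L) with hT₁
  set T₂ := Subring.intClosure (S.toSubring ∪ {t, t⁻¹} : Set L) with hT₂
  have hT₀₂ : T₀ ≤ T₂ := Subring.intClosure_mono (Set.union_subset_union_right _ (by simp))
  have hT₁₂ : T₁ ≤ T₂ := Subring.intClosure_mono (Set.union_subset_union_right _ (by simp))
  have hST₀ : S.toSubring ≤ T₀ := Set.subset_union_left.trans (Subring.subset_intClosure _)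
  have hST₁ : S.toSubring ≤ T₁ := Set.subset_union_left.trans (Subring.subset_intClosure _)
  have hST₂ : S.toSubring ≤ T₂ := hST₀.trans hT₀₂
  obtain ⟨f₀, hf₀, e₀, hQ₀, hP₀⟩ := exists_idempotent_of_maximal hP hQ hPQ hDS hmax ht hT₀
  obtain ⟨f₁, hf₁, e₁, hQ₁, hP₁⟩ := exists_idempotent_of_maximal hP hQ hPQ hDS hmax ht' hT₁
  set m := maximalIdeal S.toSubring
  have hmono {T T' : Subring L} (hTT' : T ≤ T') {x : L}
      (hx : x ∈ Submodule.span T (S.toSubring.subtype '' m)) :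
      x ∈ Submodule.span T' (S.toSubring.subtype '' m) := by
    induction hx using Submodule.span_induction with
    | mem x hx => exact Submodule.subset_span hx
    | zero => exact ZeroMemClass.zero_mem _
    | add x y _ _ hx hy => exact AddMemClass.add_mem hx hy
    | smul a x _ hx => exact Submodule.smul_mem _ (Subring.inclusion hTT' a) hx
  have e₂ : f₀ - f₁ ∈ Submodule.span T₂ (S.toSubring.subtype '' m) := by
    let F₀ : T₂ := ⟨f₀, hT₀₂ hf₀⟩
    let F₁ : T₂ := ⟨f₁, hT₁₂ hf₁⟩
    set I := m.map (Subring.inclusion hST₂)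
    have h₀ : F₀ ^ 2 - F₀ ∈ I := (coe_mem_span_iff hST₂ m _).mp (hmono hT₀₂ e₀)
    have h₁ : F₁ ^ 2 - F₁ ∈ I := (coe_mem_span_iff hST₂ m _).mp (hmono hT₁₂ e₁)
    have hrad : F₀ - F₁ ∈ I.radical := mem_radical_of_forall_mem_nonunits hST₂ fun V hSV hTV ↦ by
      change f₀ - f₁ ∈ _
      obtain h | h := hPQ V (hDS.trans hSV)
      · rw [← sub_sub_sub_cancel_left f₁ f₀ 1]
        exact V.nonunits.sub_mem (hP₁ V hSV (hT₁₂.trans hTV) h) (hP₀ V hSV (hT₀₂.trans hTV) h)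
      · exact V.nonunits.sub_mem (hQ₀ V hSV (hT₀₂.trans hTV) h) (hQ₁ V hSV (hT₁₂.trans hTV) h)
    refine (coe_mem_span_iff hST₂ m (F₀ - F₁)).mpr ?_
    rw [← Ideal.Quotient.eq_zero_iff_mem, map_sub, pow_two, map_mul, sub_eq_zero] at h₀ h₁
    obtain ⟨n, hn⟩ := hrad
    rw [← Ideal.Quotient.eq]
    refine eq_of_isNilpotent_sub_of_isIdempotentElem h₀ h₁ ⟨n, ?_⟩
    rw [← map_sub, ← map_pow, Ideal.Quotient.eq_zero_iff_mem]
    exact hn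
  obtain ⟨g₀, hg₀, g₁, hg₁, hg⟩ := Subring.exists_sub_eq_add_of_idempotent S.toSubring m
    (fun r hr ↦ (isUnit_or_isUnit_one_sub_self r).resolve_left
      ((mem_maximalIdeal r).mp hr)) ht0 hf₀ hf₁ e₀ e₁ e₂
  have hspan {T : Subring L} {V : ValuationSubring L} (hSV : S ≤ V.toLocalSubring)
      (hTV : T ≤ V.toSubring) {x : L}
      (hx : x ∈ Submodule.span T (S.toSubring.subtype '' m)) : x ∈ V.nonunits := by
    induction hx using Submodule.span_induction with
    | mem x hx =>
      obtain ⟨y, hy, rfl⟩ := hx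
      exact (le_toLocalSubring_iff.mp hSV).2 y hy
    | zero => exact V.nonunits.zero_mem
    | add x y _ _ hx hy => exact V.nonunits.add_mem hx hy
    | smul a x _ hx => exact V.mul_mem_nonunits (hTV a.2) hx
  -- the glued function
  set f := f₀ - g₀ with hf
  have hf' : f = f₁ + g₁ := by linear_combination hg
  have hcover (V : ValuationSubring L) (hSV : S.toSubring ≤ V.toSubring) :
      T₀ ≤ V.toSubring ∨ T₁ ≤ V.toSubring := by
    refine (V.mem_or_inv_mem t).imp (fun h ↦ ?_) (fun h ↦ ?_)
    · exact Subring.intClosure_le (Set.union_subset hSV (by simpa using h))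
    · exact Subring.intClosure_le (Set.union_subset hSV (by simpa using h))
  have hspanT {T : Subring L} (hST : S.toSubring ≤ T) {x : L}
      (hx : x ∈ Submodule.span T (S.toSubring.subtype '' m)) : x ∈ T := by
    induction hx using Submodule.span_induction with
    | mem x hx => obtain ⟨y, hy, rfl⟩ := hx; exact hST y.2
    | zero => exact T.zero_mem
    | add x y _ _ hx hy => exact T.add_mem hx hy
    | smul a x _ hx => exact T.mul_mem a.2 hx
  have hfS : f ∈ S.toSubring := by
    by_contra hfS
    obtain ⟨V, hSV, hfV⟩ := Subring.exists_le_valuationSubring_of_isIntegrallyClosedIn hfS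
    obtain h | h := hcover V hSV
    · exact hfV (h (T₀.sub_mem hf₀ (hspanT hST₀ hg₀)))
    · exact hfV (hf' ▸ h (T₁.add_mem hf₁ (hspanT hST₁ hg₁)))
  have hfQ : f ∈ VQ.nonunits := by
    obtain h | h := hcover VQ hSVQ.1
    · exact VQ.nonunits.sub_mem (hQ₀ VQ hSVQ h hVQ) (hspan hSVQ h hg₀)
    · rw [hf']
      exact VQ.nonunits.add_mem (hQ₁ VQ hSVQ h hVQ) (hspan hSVQ h hg₁)
  have hfP : 1 - f ∈ VP.nonunits := by
    obtain h | h := hcover VP hSVP.1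
    · rw [hf, ← sub_add]
      exact VP.nonunits.add_mem (hP₀ VP hSVP h hVP) (hspan hSVP h hg₀)
    · rw [hf', ← sub_sub]
      exact VP.nonunits.sub_mem (hP₁ VP hSVP h hVP) (hspan hSVP h hg₁)
  have key (V : ValuationSubring L) (hSV : S ≤ V.toLocalSubring) (x : S.toSubring)
      (hx : IsUnit x) : (x : L) ∉ V.nonunits := fun hxV ↦ by
    obtain ⟨c, hc⟩ := hx.exists_left_inv
    have hc' : (c : L) * x = 1 := congr_arg Subtype.val hc
    exact V.one_notMem_nonunits (hc' ▸ V.mul_mem_nonunits (hSV.1 c.2) hxV)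
  obtain h | h := isUnit_or_isUnit_one_sub_self (⟨f, hfS⟩ : S.toSubring)
  · exact key VQ hSVQ _ h hfQ
  · exact key VP hSVP _ h hfP

end ValuationSubring

end

section

open Polynomial IsLocalRing

theorem HenselianLocalRing.exists_section_of_etale {R : Type u} {R' : Type v} [CommRing R]
    [HenselianLocalRing R] [CommRing R'] [Algebra R R'] [Algebra.Etale R R']
    (ψ : R' →ₐ[R] ResidueField R) :
    ∃ σ : R' →ₐ[R] R, ∀ r, residue R (σ r) = ψ r := by
  have : (RingHom.ker ψ).IsPrime := RingHom.ker_isPrime _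
  obtain ⟨f, hf, ⟨⟨S⟩⟩⟩ := Algebra.IsEtaleAt.exists_isStandardEtale (R := R) (RingHom.ker ψ)
  have hu : ∀ y : Submonoid.powers f, IsUnit (ψ y) := by
    rintro ⟨_, n, rfl⟩
    simpa using (IsUnit.mk0 (ψ f) hf).pow n
  let ψ' : Localization.Away f →ₐ[R] ResidueField R :=
    IsLocalization.liftAlgHom (M := Submonoid.powers f) hu
  have h₀ : S.P.HasMap (ψ' S.x) := S.hasMap.map ψ'
  have hensel : ∀ f : R[X], f.Monic → ∀ a₀ : ResidueField R, aeval a₀ f = 0 →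
      aeval a₀ (derivative f) ≠ 0 → ∃ a : R, f.IsRoot a ∧ residue R a = a₀ := by
    have h := (HenselianLocalRing.TFAE R).out 0 1
    exact h.mp ‹_›
  obtain ⟨a, ha, haS⟩ := hensel S.P.f S.P.monic_f (ψ' S.x) h₀.1 h₀.isUnit_derivative_f.ne_zero
  have h : S.P.HasMap a := by
    refine ⟨by simpa [IsRoot, aeval_def, eval₂_id] using ha, ?_⟩
    refine isUnit_of_map_unit (residue R) _ ?_
    have := h₀.2
    rw [← haS] at this
    change IsUnit (aeval (algebraMap R (ResidueField R) a) _) at this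
    rwa [aeval_algebraMap_apply] at this
  let τ : Localization.Away f →ₐ[R] R := (S.P.lift a h).comp S.equivRing.toAlgHom
  have hτ : τ S.x = a := by
    have : S.equivRing S.x = S.P.X := by
      rw [← S.equivRing_symm_X, AlgEquiv.apply_symm_apply]
    simp [τ, this]
  have key : (Algebra.ofId R (ResidueField R)).comp τ = ψ' := by
    apply S.hom_ext
    simp only [AlgHom.comp_apply, hτ]
    exact haS
  refine ⟨τ.comp (IsScalarTower.toAlgHom R R' _), fun r => ?_⟩
  have := DFunLike.congr_fun key (algebraMap R' _ r)
  simpa [ψ'] using this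

open TensorProduct in
/-- A finite algebra which is a domain over a Henselian local ring is local. -/
theorem HenselianLocalRing.isLocalRing_of_finite {R : Type u} {S : Type v} [CommRing R]
    [HenselianLocalRing R] [CommRing S] [IsDomain S] [Algebra R S] [Module.Finite R S] :
    IsLocalRing S := by
  have hover : ∀ q : Ideal S, q.IsMaximal → q.LiesOver (maximalIdeal R) := fun q hq => by
    have := Ideal.isMaximal_comap_of_isIntegral_of_isMaximal (R := R) q
    exact ⟨(IsLocalRing.eq_maximalIdeal this).symm⟩
  obtain ⟨q, hq⟩ := Ideal.exists_maximal S
  have := hover q hq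
  obtain ⟨R', _, _, _, P, _, _, e, he, P', _, _, hP', heP', hbij, -, huniq⟩ :=
    Algebra.exists_etale_isIdempotentElem_forall_liesOver_eq (maximalIdeal R) q
  let ε₁ : ResidueField R ≃ₐ[R] (maximalIdeal R).ResidueField :=
    AlgEquiv.ofBijective
      (IsScalarTower.toAlgHom R (R ⧸ maximalIdeal R) (maximalIdeal R).ResidueField)
      (Ideal.bijective_algebraMap_quotient_residueField (maximalIdeal R))
  let ε₂ : (maximalIdeal R).ResidueField ≃ₐ[R] P.ResidueField := AlgEquiv.ofBijective _ hbij
  let ψ : R' →ₐ[R] ResidueField R :=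
    ((ε₁.trans ε₂).symm : P.ResidueField →ₐ[R] ResidueField R).comp
      (IsScalarTower.toAlgHom R R' P.ResidueField)
  have hψ : ∀ r, ψ r = 0 ↔ r ∈ P := fun r => by simp [ψ]
  obtain ⟨σ, hσ⟩ := HenselianLocalRing.exists_section_of_etale ψ
  have hσP : ∀ r, σ r ∈ maximalIdeal R ↔ r ∈ P := fun r => by
    rw [← hψ, ← hσ, residue_eq_zero_iff]
  let φ : R' ⊗[R] S →ₐ[R] S :=
    Algebra.TensorProduct.lift ((Algebra.ofId R S).comp σ) (AlgHom.id R S) fun _ _ => .all _ _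
  have hφP : ∀ Q : Ideal S, Q.IsMaximal → (Q.comap φ).LiesOver P := fun Q hQ => by
    have := hover Q hQ
    refine ⟨?_⟩
    ext r
    rw [← hσP, Ideal.mem_of_liesOver Q (maximalIdeal R)]
    simp [φ, Algebra.ofId_apply]
  have hφr : ∀ Q : Ideal S, (Q.comap φ).comap
      (Algebra.TensorProduct.includeRight : S →ₐ[R] R' ⊗[R] S).toRingHom = Q := fun Q => by
    ext s
    simp [φ]
  have hφe : φ e = 1 := by
    refine (IsIdempotentElem.iff_eq_zero_or_one.mp (he.map φ)).resolve_left fun h0 => heP' ?_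
    have := hφP q hq
    have := hq.isPrime
    rw [← Ideal.eq_of_comap_eq_comap_of_bijective_residueFieldMap hbij (q.comap φ) P'
      ((hφr q).trans hP'.symm), Ideal.mem_comap, h0]
    exact q.zero_mem
  refine .of_unique_max_ideal ⟨q, hq, fun Q hQ => ?_⟩
  have hQ' := hQ.isPrime
  have := huniq (Q.comap φ) inferInstance (hφP Q hQ) fun h => hQ.ne_top <| by
    rwa [Ideal.mem_comap, hφe, ← Ideal.eq_top_iff_one] at h
  rw [← hφr Q, this, hP']

theorem HenselianLocalRing.isLocalRing_of_isIntegral {R : Type u} {S : Type v} [CommRing R]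
    [HenselianLocalRing R] [CommRing S] [IsDomain S] [Algebra R S] [Algebra.IsIntegral R S] :
    IsLocalRing S := by
  refine .of_isUnit_or_isUnit_one_sub_self fun s => ?_
  have : Module.Finite R (Algebra.adjoin R {s}) :=
    ⟨(Submodule.fg_top _).mpr (Algebra.IsIntegral.isIntegral s).fg_adjoin_singleton⟩
  have := HenselianLocalRing.isLocalRing_of_finite (R := R) (S := Algebra.adjoin R {s})
  let t : Algebra.adjoin R {s} := ⟨s, Algebra.self_mem_adjoin_singleton R s⟩
  exact (IsLocalRing.isUnit_or_isUnit_one_sub_self t).imp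
    (fun h => h.map (Algebra.adjoin R {s}).val) fun h => h.map (Algebra.adjoin R {s}).val

end

section

open IsLocalRing

theorem HenselianLocalRing.isLocalRing_intClosure_range {R : Type u} {L : Type v} [CommRing R]
    [HenselianLocalRing R] [Field L] (f : R →+* L) :
    IsLocalRing (Subring.intClosure (f.range : Set L)) := by
  let A : Subring L := Subring.closure (f.range : Set L)
  have hA : f.range ≤ A := Subring.subset_closure
  let : Algebra R L := f.toAlgebra
  let : Algebra R A := ((Subring.inclusion hA).comp f.rangeRestrict).toAlgebra
  have : IsScalarTower R A L := .of_algebraMap_eq fun _ => rfl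
  have : Algebra.IsIntegral R A := by
    refine Algebra.isIntegral_of_surjective ?_
    rintro ⟨x, hx⟩
    obtain ⟨r, rfl⟩ : x ∈ f.range := (Subring.closure_eq f.range).le hx
    exact ⟨r, rfl⟩
  have hr : ∀ r, f r ∈ Subring.intClosure (f.range : Set L) := fun r =>
    Subring.subset_intClosure _ ⟨r, rfl⟩
  let : Algebra R (Subring.intClosure (f.range : Set L)) := (f.codRestrict _ hr).toAlgebra
  have : Algebra.IsIntegral R (Subring.intClosure (f.range : Set L)) := by
    refine ⟨fun x => ?_⟩
    let ι : Subring.intClosure (f.range : Set L) →ₐ[R] L :=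
      { (Subring.intClosure (f.range : Set L)).subtype with commutes' := fun _ => rfl }
    refine (isIntegral_algHom_iff ι Subtype.val_injective).mp ?_
    exact isIntegral_trans (A := A) _ (Subring.mem_intClosure.mp x.2)
  exact HenselianLocalRing.isLocalRing_of_isIntegral (R := R)

end

section

open AlgebraicGeometry CategoryTheory CategoryTheory.Limits IsLocalRing

namespace AlgebraicGeometry.Scheme

variable {W : Scheme.{u}} {x : W} {V : ValuationSubring (W.residueField x)}

/-- The morphism `l : Spec V ⟶ W` extends the canonical morphism `Spec κ(x) ⟶ W`. -/
def IsExtension {x : W} (V : ValuationSubring (W.residueField x)) (l : Spec (.of V) ⟶ W) : Prop :=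
  Spec.map (CommRingCat.ofHom (algebraMap V (W.residueField x))) ≫ l = W.fromSpecResidueField x

lemma IsExtension.specializes {l : Spec (.of V) ⟶ W} (hl : IsExtension V l) :
    x ⤳ l (closedPoint V) := by
  let i := Spec.map (CommRingCat.ofHom (algebraMap V (W.residueField x)))
  have h (z : Spec (W.residueField x)) : l (i z) = x :=
    (congr($hl z)).trans (Scheme.fromSpecResidueField_apply _ _)
  exact (specializes_of_eq (h (closedPoint (W.residueField x))).symm).trans
    ((specializes_closedPoint (R := V) (i (closedPoint (W.residueField x)))).map l.continuous)

lemma IsExtension.evaluation_eq {l : Spec (.of V) ⟶ W} (hl : IsExtension V l) {U : W.Opens}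
    (hU : IsAffineOpen U) (hlU : l (closedPoint V) ∈ U) (hx : x ∈ U) :
    W.evaluation U x hx = W.presheaf.germ U _ hlU ≫ Scheme.stalkClosedPointTo l ≫
      CommRingCat.ofHom (algebraMap V (W.residueField x)) := by
  rw [← Spec.map_inj, ← cancel_mono hU.fromSpec]
  simp only [Spec.map_comp, Category.assoc]
  have h1 : Spec.map (W.presheaf.germ U _ hlU) ≫ hU.fromSpec = W.fromSpecStalk _ :=
    hU.fromSpecStalk_eq_fromSpecStalk hlU
  have h2 : Spec.map (W.presheaf.germ U _ hx) ≫ hU.fromSpec = W.fromSpecStalk _ :=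
    hU.fromSpecStalk_eq_fromSpecStalk hx
  rw [h1, Scheme.Spec_stalkClosedPointTo_fromSpecStalk, hl, ← Scheme.germ_residue, Spec.map_comp,
    Category.assoc, h2, Scheme.fromSpecResidueField]

lemma IsExtension.evaluation_mem {l : Spec (.of V) ⟶ W} (hl : IsExtension V l) {U : W.Opens}
    (hU : IsAffineOpen U) (hlU : l (closedPoint V) ∈ U) (hx : x ∈ U) (s : Γ(W, U)) :
    W.evaluation U x hx s ∈ V := by
  rw [hl.evaluation_eq hU hlU hx]
  exact Subtype.prop (stalkClosedPointTo l (W.presheaf.germ U _ hlU s))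

lemma IsExtension.evaluation_mem_nonunits_iff {l : Spec (.of V) ⟶ W} (hl : IsExtension V l)
    {U : W.Opens} (hU : IsAffineOpen U) (hlU : l (closedPoint V) ∈ U) (hx : x ∈ U) (s : Γ(W, U)) :
    W.evaluation U x hx s ∈ V.nonunits ↔ l (closedPoint V) ∉ W.basicOpen s := by
  rw [hl.evaluation_eq hU hlU hx, W.mem_basicOpen _ _ hlU]
  refine (ValuationSubring.coe_mem_nonunits_iff
    (a := stalkClosedPointTo l (W.presheaf.germ U _ hlU s))).trans ?_
  rw [mem_maximalIdeal, _root_.mem_nonunits_iff, not_iff_not]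
  exact isUnit_map_iff (stalkClosedPointTo l).hom _

lemma exists_isExtension_of_evaluation_mem {U : W.Opens} (hU : IsAffineOpen U) (hx : x ∈ U)
    (h : ∀ s, W.evaluation U x hx s ∈ V) :
    ∃ l, IsExtension V l ∧ l (closedPoint V) ∈ U := by
  refine ⟨Spec.map (CommRingCat.ofHom ((W.evaluation U x hx).hom.codRestrict V.toSubring h)) ≫
    hU.fromSpec, ?_, ?_⟩
  · rw [IsExtension, ← Spec.map_comp_assoc]
    change Spec.map (W.evaluation U x hx) ≫ _ = _
    have h2 : Spec.map (W.presheaf.germ U _ hx) ≫ hU.fromSpec = W.fromSpecStalk _ :=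
      hU.fromSpecStalk_eq_fromSpecStalk hx
    rw [← Scheme.germ_residue, Spec.map_comp, Category.assoc, h2, Scheme.fromSpecResidueField]
  · exact hU.range_fromSpec.le (Set.mem_range_self (Spec.map (CommRingCat.ofHom
      ((W.evaluation U x hx).hom.codRestrict V.toSubring h)) (closedPoint V)))

lemma exists_isExtension_of_specializes {y : W} (h : x ⤳ y) :
    ∃ (V : ValuationSubring (W.residueField x)) (l : _),
      IsExtension V l ∧ l (closedPoint V) = y := by
  let φ : W.presheaf.stalk y ⟶ W.residueField x := W.presheaf.stalkSpecializes h ≫ W.residue x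
  obtain ⟨V, hV, hloc⟩ := exists_factor_valuationRing φ.hom
  let ψ : W.presheaf.stalk y ⟶ .of V := CommRingCat.ofHom (φ.hom.codRestrict _ hV)
  refine ⟨V, Spec.map ψ ≫ W.fromSpecStalk y, ?_, ?_⟩
  · rw [IsExtension, Scheme.fromSpecResidueField, ← Scheme.SpecMap_stalkSpecializes_fromSpecStalk h]
    simp_rw [← Spec.map_comp_assoc]
    rfl
  · have : Spec.map ψ (closedPoint V) = closedPoint (W.presheaf.stalk y) :=
      comap_closedPoint (S := V) (φ.hom.codRestrict V.toSubring hV)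
    exact congr(W.fromSpecStalk y $this).trans W.fromSpecStalk_closedPoint

end AlgebraicGeometry.Scheme


lemma LocalSubring.range_comp_le_toLocalSubring_iff {R L : Type*} [CommRing R] [IsLocalRing R]
    [Field L] {V : ValuationSubring L} (φ : R →+* V) :
    LocalSubring.range ((algebraMap V L).comp φ) ≤ V.toLocalSubring ↔ IsLocalHom φ := by
  rw [ValuationSubring.le_toLocalSubring_iff]
  let ρ : R →+* (LocalSubring.range ((algebraMap V L).comp φ)).toSubring :=
    ((algebraMap V L).comp φ).rangeRestrict
  have hρ : Function.Surjective ρ := ((algebraMap V L).comp φ).rangeRestrict_surjective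
  have hρφ (r : R) : (ρ r : L) = φ r := rfl
  constructor
  · rintro ⟨-, h⟩
    have : IsLocalHom ρ := .of_surjective ρ hρ
    refine ⟨fun r hr => of_not_not fun hr' => ?_⟩
    have := h (ρ r) (by rwa [mem_maximalIdeal, _root_.mem_nonunits_iff, isUnit_map_iff])
    rw [hρφ, ValuationSubring.coe_mem_nonunits_iff] at this
    exact this hr
  · intro h
    refine ⟨?_, fun x hx => ?_⟩
    · rintro _ ⟨r, rfl⟩
      exact (φ r).2
    · obtain ⟨r, rfl⟩ := hρ x
      rw [hρφ, ValuationSubring.coe_mem_nonunits_iff, mem_maximalIdeal, _root_.mem_nonunits_iff,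
        isUnit_map_iff]
      exact fun hr => hx (hr.map ρ)

namespace AlgebraicGeometry.Scheme

variable {R : Type u} [CommRing R] {W : Scheme.{u}} (g : W ⟶ Spec (CommRingCat.of R)) (x : W)

/-- The structure map from the base ring to the residue field. -/
noncomputable def toResidueField : R →+* W.residueField x :=
  (Spec.preimage (W.fromSpecResidueField x ≫ g)).hom

lemma SpecMap_toResidueField :
    Spec.map (CommRingCat.ofHom (toResidueField g x)) = W.fromSpecResidueField x ≫ g :=
  Spec.map_preimage _

variable {x} {V : ValuationSubring (W.residueField x)}

lemma IsExtension.algebraMap_comp {l : Spec (.of V) ⟶ W} (hl : IsExtension V l) :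
    (algebraMap V (W.residueField x)).comp (Spec.preimage (l ≫ g)).hom = toResidueField g x := by
  have : Spec.preimage (l ≫ g) ≫ CommRingCat.ofHom (algebraMap V (W.residueField x)) =
      CommRingCat.ofHom (toResidueField g x) := by
    rw [← Spec.map_inj, Spec.map_comp, Spec.map_preimage, SpecMap_toResidueField, ← hl,
      Category.assoc]
  exact congr(($this).hom)

lemma IsExtension.comp_eq_comp {l l' : Spec (.of V) ⟶ W} (hl : IsExtension V l)
    (hl' : IsExtension V l') : l ≫ g = l' ≫ g := by
  rw [← Spec.map_preimage (l ≫ g), ← Spec.map_preimage (l' ≫ g)]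
  congr 1
  ext r
  have := (hl.algebraMap_comp g).trans (hl'.algebraMap_comp g).symm
  exact DFunLike.congr_fun this r

variable {g} in
lemma IsExtension.eq [IsSeparated g] {l l' : Spec (.of V) ⟶ W} (hl : IsExtension V l)
    (hl' : IsExtension V l') : l = l' := by
  have w : CommSq (W.fromSpecResidueField x) (Spec.map (CommRingCat.ofHom
      (algebraMap V (W.residueField x)))) g (l ≫ g) := ⟨by
    rw [← hl]
    exact Category.assoc _ _ _⟩
  have : Subsingleton w.LiftStruct :=
    IsSeparated.valuativeCriterion g { R := V, K := W.residueField x, commSq := w, .. }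
  exact congr_arg CommSq.LiftStruct.l (Subsingleton.elim
    (α := w.LiftStruct) ⟨l, hl, rfl⟩ ⟨l', hl', hl'.comp_eq_comp g hl⟩)

variable [IsLocalRing R]

lemma IsExtension.range_le_toLocalSubring_iff {l : Spec (.of V) ⟶ W} (hl : IsExtension V l) :
    LocalSubring.range (toResidueField g x) ≤ V.toLocalSubring ↔
      g (l (closedPoint V)) = closedPoint R := by
  have h1 : g (l (closedPoint V)) = closedPoint R ↔ IsLocalHom (Spec.preimage (l ≫ g)).hom := by
    rw [isLocalHom_iff_comap_closedPoint]
    have : g (l (closedPoint V)) = Spec.map (Spec.preimage (l ≫ g)) (closedPoint V) := by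
      rw [Spec.map_preimage]
      rfl
    rw [this]
    rfl
  rw [h1, ← LocalSubring.range_comp_le_toLocalSubring_iff, hl.algebraMap_comp g]

lemma exists_isExtension [UniversallyClosed g]
    (h : LocalSubring.range (toResidueField g x) ≤ V.toLocalSubring) : ∃ l, IsExtension V l := by
  have hV := LocalSubring.toSubring_mono h
  let φ : R →+* V := (toResidueField g x).codRestrict V.toSubring fun r => hV ⟨r, rfl⟩
  have w : CommSq (W.fromSpecResidueField x) (Spec.map (CommRingCat.ofHom
      (algebraMap V (W.residueField x)))) g (Spec.map (CommRingCat.ofHom φ)) := by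
    refine ⟨?_⟩
    rw [← SpecMap_toResidueField]
    exact Spec.map_comp (CommRingCat.ofHom φ) (CommRingCat.ofHom (algebraMap V (W.residueField x)))
  have H : ValuativeCriterion.Existence g :=
    (UniversallyClosed.eq_valuativeCriterion.le _ _ g ‹_›).1
  obtain ⟨⟨l, hl, -⟩⟩ := (H { R := V, K := W.residueField x, commSq := w, .. }).exists_lift
  exact ⟨l, hl⟩

end AlgebraicGeometry.Scheme

namespace AlgebraicGeometry.Scheme

open Filter

variable {W : Scheme.{u}} {x : W}

/-- The valuation ring `V` of `κ(x)` has a centre in `A`. -/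
def HasCenterIn {x : W} (A : Set W) (V : ValuationSubring (W.residueField x)) : Prop :=
  ∃ l, IsExtension V l ∧ l (closedPoint V) ∈ A

lemma HasCenterIn.ultralimit [CompactSpace W] {A : Set W} (hA : IsClosed A) {J : Type*}
    (F : Ultrafilter J) (V : J → ValuationSubring (W.residueField x))
    (hV : ∀ j, HasCenterIn A (V j)) : HasCenterIn A (ValuationSubring.ultralimit F V) := by
  choose l hl hlA using hV
  obtain ⟨s, hs, hsW⟩ := isCompact_and_isOpen_iff_finite_and_eq_biUnion_affineOpens.mp
    (⟨isCompact_univ, isOpen_univ⟩ : IsCompact (Set.univ : Set W) ∧ IsOpen (Set.univ : Set W))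
  have hcov : ∀ᶠ j in F, ∃ U ∈ s, l j (closedPoint (V j)) ∈ U.1 := .of_forall fun j => by
    simpa using hsW.le (Set.mem_univ (l j (closedPoint (V j))))
  obtain ⟨U, hUs, hU⟩ := (Ultrafilter.eventually_exists_mem_iff hs).mp hcov
  obtain ⟨j₀, hj₀⟩ := hU.exists
  have hx : x ∈ U.1 := (hl j₀).specializes.mem_open U.1.2 hj₀
  have hmem : ∀ s, W.evaluation U.1 x hx s ∈ ValuationSubring.ultralimit F V := fun s =>
    ValuationSubring.mem_ultralimit.mpr <| hU.mono fun j hj => (hl j).evaluation_mem U.2 hj hx s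
  obtain ⟨l', hl', hl'U⟩ := exists_isExtension_of_evaluation_mem U.2 hx hmem
  refine ⟨l', hl', of_not_not fun hn => ?_⟩
  obtain ⟨f, hfA, hf⟩ := U.2.exists_basicOpen_le  (V := ⟨Aᶜ, hA.isOpen_compl⟩) ⟨_, hn⟩ hl'U
  have h1 : ∀ᶠ j in F, W.evaluation U.1 x hx f ∈ (V j).nonunits := hU.mono fun j hj =>
    ((hl j).evaluation_mem_nonunits_iff U.2 hj hx f).mpr fun h => hfA h (hlA j)
  exact (hl'.evaluation_mem_nonunits_iff U.2 hl'U hx f).mp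
    (ValuationSubring.mem_nonunits_ultralimit.mpr h1) hf

lemma isClosedClass_hasCenterIn {R : Type u} [CommRing R] [IsLocalRing R]
    (g : W ⟶ Spec (CommRingCat.of R)) [IsProper g] {A : Set W} (hA : IsClosed A)
    (hAg : ∀ a ∈ A, g a = closedPoint R) :
    ValuationSubring.IsClosedClass (LocalSubring.range (toResidueField g x)) (HasCenterIn A) where
  le := by
    rintro V ⟨l, hl, hlA⟩
    exact (hl.range_le_toLocalSubring_iff g).mpr (hAg _ hlA)
  mono := by
    rintro V V' hle hV' ⟨l, hl, hlA⟩
    obtain ⟨l', hl'⟩ := exists_isExtension g hV'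
    refine ⟨l', hl', ?_⟩
    let i : Spec (.of V) ⟶ Spec (.of V') :=
      Spec.map (CommRingCat.ofHom (ValuationSubring.inclusion V' V hle))
    have h : IsExtension V (i ≫ l') := by
      rw [IsExtension, ← Category.assoc, ← hl']
      congr 1
      exact (Spec.map_comp _ _).symm
    rw [hl.eq (g := g) h] at hlA
    exact ((specializes_closedPoint (R := V') (i (closedPoint V))).map l'.continuous).mem_closed
      hA hlA
  ultralimit F V hV := by
    have : CompactSpace W := QuasiCompact.compactSpace_of_compactSpace g
    exact HasCenterIn.ultralimit hA F V hV

theorem not_specializes_of_henselianLocalRing {R : Type u} [CommRing R] [HenselianLocalRing R]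
    (g : W ⟶ Spec (CommRingCat.of R)) [IsProper g] {A B : Set W} (hA : IsClosed A) (hB : IsClosed B)
    (hAB : Disjoint A B) (h : A ∪ B = g ⁻¹' {closedPoint R}) {a b : W} (ha : a ∈ A) (hb : b ∈ B)
    (hxa : x ⤳ a) : ¬ x ⤳ b := by
  intro hxb
  have hAg : ∀ a ∈ A, g a = closedPoint R := fun a ha => h.le (.inl ha)
  have hBg : ∀ a ∈ B, g a = closedPoint R := fun a ha => h.le (.inr ha)
  have hP := isClosedClass_hasCenterIn (x := x) g hA hAg
  have hQ := isClosedClass_hasCenterIn (x := x) g hB hBg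
  have hdisj (V : ValuationSubring (W.residueField x)) : HasCenterIn A V → ¬ HasCenterIn B V := by
    rintro ⟨l, hl, hlA⟩ ⟨l', hl', hlB⟩
    rw [← hl.eq (g := g) hl'] at hlB
    exact hAB.le_bot ⟨hlA, hlB⟩
  have : IsLocalRing (Subring.intClosure
      ((LocalSubring.range (toResidueField g x)).toSubring : Set (W.residueField x))) :=
    HenselianLocalRing.isLocalRing_intClosure_range (toResidueField g x)
  obtain ⟨V, l, hl, hla⟩ := exists_isExtension_of_specializes hxa
  obtain ⟨V', l', hl', hlb⟩ := exists_isExtension_of_specializes hxb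
  have hVA : HasCenterIn A V := ⟨l, hl, hla ▸ ha⟩
  have hVB : HasCenterIn B V' := ⟨l', hl', hlb ▸ hb⟩
  have hPQ (V : ValuationSubring (W.residueField x))
      (hV : LocalSubring.range (toResidueField g x) ≤ V.toLocalSubring) :
      HasCenterIn A V ∨ HasCenterIn B V := by
    obtain ⟨l, hl⟩ := exists_isExtension g hV
    exact (h.ge ((hl.range_le_toLocalSubring_iff g).mp hV)).imp
      (fun h => ⟨l, hl, h⟩) fun h => ⟨l, hl, h⟩
  rcases ValuationSubring.forall_or_forall_of_isClosedClass hP hQ hPQ hdisj with H | H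
  · exact hdisj V' (H V' (hQ.le hVB)) hVB
  · exact hdisj V hVA (H V (hP.le hVA))

end AlgebraicGeometry.Scheme

end

section

open TopologicalSpace Topology

lemma IsCompact.exists_specializes_of_forall_isOpen {X : Type*} [TopologicalSpace X]
    [PrespectralSpace X] {K : Set X} (hK : IsCompact K) {x : X}
    (h : ∀ U : Set X, IsOpen U → IsCompact U → K ⊆ U → x ∈ U) : ∃ a ∈ K, x ⤳ a := by
  by_contra! hx
  obtain ⟨U, hU, hUc, hKU, hxU⟩ : ∃ U : Set X, IsOpen U ∧ IsCompact U ∧ K ⊆ U ∧ x ∉ U := by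
    refine hK.induction_on ⟨∅, isOpen_empty, isCompact_empty, subset_rfl, id⟩ ?_ ?_ fun a ha => ?_
    · rintro s t hst ⟨U, hU, hUc, htU, hxU⟩
      exact ⟨U, hU, hUc, hst.trans htU, hxU⟩
    · rintro s t ⟨U, hU, hUc, hsU, hxU⟩ ⟨V, hV, hVc, htV, hxV⟩
      exact ⟨U ∪ V, hU.union hV, hUc.union hVc, Set.union_subset_union hsU htV,
        fun h => h.elim hxU hxV⟩
    · obtain ⟨O, hO, haO, hxO⟩ : ∃ O : Set X, IsOpen O ∧ a ∈ O ∧ x ∉ O := by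
        simpa [specializes_iff_forall_open] using hx a ha
      obtain ⟨U, ⟨hU, hUc⟩, haU, hUO⟩ :=
        PrespectralSpace.isTopologicalBasis.exists_subset_of_mem_open haO hO
      exact ⟨U, mem_nhdsWithin_of_mem_nhds (hU.mem_nhds haU), U, hU, hUc, subset_rfl,
        fun h => hxO (hUO h)⟩
  exact hxU (h U hU hUc hKU)

/-- In a quasi-compact and quasi-separated spectral space, closed subsets without common
generalization have disjoint neighbourhoods. -/
lemma separatedNhds_of_forall_not_specializes {X : Type*} [TopologicalSpace X] [CompactSpace X]
    [QuasiSober X] [PrespectralSpace X] [QuasiSeparatedSpace X] {A B : Set X} (hA : IsCompact A)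
    (hB : IsCompact B) (h : ∀ x, ∀ a ∈ A, ∀ b ∈ B, x ⤳ a → ¬ x ⤳ b) : SeparatedNhds A B := by
  let N (A : Set X) : Type _ := {U : Set X // IsOpen U ∧ IsCompact U ∧ A ⊆ U}
  let t (i : N A × N B) : Set (WithConstructibleTopology X) :=
    WithTopology.ofTopology ⁻¹' (i.1.1 ∩ i.2.1)
  have : Nonempty (N A × N B) := ⟨⟨Set.univ, isOpen_univ, isCompact_univ, Set.subset_univ _⟩,
    ⟨Set.univ, isOpen_univ, isCompact_univ, Set.subset_univ _⟩⟩
  have hc {U : Set X} (hU : IsOpen U) (hU' : IsCompact U) :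
      IsClosed[constructibleTopology X] U := by
    rw [← @isOpen_compl_iff]
    exact IsCompact.isOpen_constructibleTopology_of_isClosed (by rwa [compl_compl])
      hU.isClosed_compl
  obtain ⟨i, hi⟩ := isCompact_univ.elim_directed_family_closed t (fun i => by
      rw [WithConstructibleTopology.isClosed_iff]
      exact @IsClosed.inter _ _ _ (constructibleTopology X) (hc i.1.2.1 i.1.2.2.1)
        (hc i.2.2.1 i.2.2.2.1))
    (by
      refine Set.eq_empty_of_forall_notMem fun x hx => ?_
      simp only [Set.univ_inter, Set.mem_iInter, t, Prod.forall] at hx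
      obtain ⟨a, ha, hxa⟩ := hA.exists_specializes_of_forall_isOpen (x := x.ofTopology)
        fun U h1 h2 h3 => (hx ⟨U, h1, h2, h3⟩ ⟨_, isOpen_univ, isCompact_univ, Set.subset_univ _⟩).1
      obtain ⟨b, hb, hxb⟩ := hB.exists_specializes_of_forall_isOpen (x := x.ofTopology)
        fun U h1 h2 h3 => (hx ⟨_, isOpen_univ, isCompact_univ, Set.subset_univ _⟩ ⟨U, h1, h2, h3⟩).2
      exact h _ a ha b hb hxa hxb)
    (by
      rintro ⟨U, V⟩ ⟨U', V'⟩
      refine ⟨⟨⟨U.1 ∩ U'.1, U.2.1.inter U'.2.1,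
          U.2.2.1.inter_of_isOpen U'.2.2.1 U.2.1 U'.2.1,
          Set.subset_inter U.2.2.2 U'.2.2.2⟩,
        ⟨V.1 ∩ V'.1, V.2.1.inter V'.2.1,
          V.2.2.1.inter_of_isOpen V'.2.2.1 V.2.1 V'.2.1,
          Set.subset_inter V.2.2.2 V'.2.2.2⟩⟩, ?_, ?_⟩
      · exact Set.preimage_mono (Set.inter_subset_inter Set.inter_subset_left Set.inter_subset_left)
      · exact Set.preimage_mono
          (Set.inter_subset_inter Set.inter_subset_right Set.inter_subset_right))
  refine ⟨i.1.1, i.2.1, i.1.2.1, i.2.2.1, i.1.2.2.2, i.2.2.2.2,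
    Set.disjoint_left.mpr fun x h1 h2 => ?_⟩
  exact Set.notMem_empty _ (hi.le ⟨Set.mem_univ (WithTopology.toTopology _ x), h1, h2⟩)

end

open AlgebraicGeometry CategoryTheory CategoryTheory.Limits

noncomputable section

lemma AlgebraicGeometry.Scheme.exists_specializes_map_eq_closedPoint {R : Type u} [CommRing R]
    [IsLocalRing R] {W : Scheme.{u}} (g : W ⟶ Spec (CommRingCat.of R)) [UniversallyClosed g]
    (x : W) : ∃ y, x ⤳ y ∧ g y = IsLocalRing.closedPoint R := by
  have hcl : IsClosed (g '' closure {x}) := g.isClosedMap _ isClosed_closure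
  obtain ⟨y, hy, hgy⟩ : IsLocalRing.closedPoint R ∈ g '' closure {x} :=
    (IsLocalRing.specializes_closedPoint (R := R) (g x)).mem_closed hcl
      ⟨x, subset_closure rfl, rfl⟩
  exact ⟨y, specializes_iff_mem_closure.mpr hy, hgy⟩

theorem AlgebraicGeometry.Scheme.isConnected_preimage_closedPoint {R : Type u} [CommRing R]
    [HenselianLocalRing R]
    {W : Scheme.{u}} (g : W ⟶ Spec (CommRingCat.of R)) [IsProper g] [ConnectedSpace W] :
    _root_.IsConnected (g ⁻¹' {IsLocalRing.closedPoint R}) := by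
  have hF : IsClosed (g ⁻¹' {IsLocalRing.closedPoint R}) :=
    (IsLocalRing.isClosed_singleton_closedPoint R).preimage g.continuous
  have : CompactSpace W := QuasiCompact.compactSpace_of_compactSpace g
  have : QuasiSeparatedSpace W := quasiSeparatedSpace_of_quasiSeparated g
  refine ⟨?_, ?_⟩
  · obtain ⟨x⟩ := ‹ConnectedSpace W›.toNonempty
    obtain ⟨y, -, hy⟩ := exists_specializes_map_eq_closedPoint g x
    exact ⟨y, hy⟩
  rw [isPreconnected_iff_subset_of_fully_disjoint_closed hF]
  intro A B hA hB hFAB hAB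
  wlog hsub : A ∪ B = g ⁻¹' {IsLocalRing.closedPoint R} generalizing A B with H
  · have := H (A ∩ g ⁻¹' {IsLocalRing.closedPoint R}) (B ∩ g ⁻¹' {IsLocalRing.closedPoint R})
      (hA.inter hF) (hB.inter hF)
      (by rw [← Set.union_inter_distrib_right]; exact Set.subset_inter hFAB subset_rfl)
      (hAB.mono Set.inter_subset_left Set.inter_subset_left)
      (by rw [← Set.union_inter_distrib_right]; exact Set.inter_eq_right.mpr hFAB)
    exact this.imp (fun h => h.trans Set.inter_subset_left) fun h => h.trans Set.inter_subset_left
  obtain ⟨U, V, hU, hV, hAU, hBV, hUV⟩ :=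
    separatedNhds_of_forall_not_specializes hA.isCompact hB.isCompact
      fun x a ha b hb => not_specializes_of_henselianLocalRing g hA hB hAB hsub ha hb
  have hcov : Set.univ ⊆ U ∪ V := fun x _ => by
    obtain ⟨y, hxy, hy⟩ := exists_specializes_map_eq_closedPoint g x
    exact (hFAB hy).imp (fun h => hxy.mem_open hU (hAU h)) fun h => hxy.mem_open hV (hBV h)
  rcases isPreconnected_univ.subset_or_subset hU hV hUV hcov with h | h
  · refine .inl fun y hy => (hFAB hy).resolve_right fun hB' => ?_
    exact hUV.le_bot ⟨h trivial, hBV hB'⟩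
  · refine .inr fun y hy => (hFAB hy).resolve_left fun hA' => ?_
    exact hUV.le_bot ⟨hAU hA', h trivial⟩

/-- Over the spectrum of a Henselian local ring, the closed fiber of a proper morphism
from a nonempty connected scheme is nonempty and connected. -/
theorem closed_fiber_connected_of_henselian
    (R : Type u) [CommRing R] [HenselianLocalRing R]
    (W : Scheme.{u}) (g : W ⟶ Spec (CommRingCat.of R)) [IsProper g]
    [Nonempty W] [ConnectedSpace W] :
    Nonempty
        ↥(pullback g (Spec.map (CommRingCat.ofHom (IsLocalRing.residue R)))) ∧
      ConnectedSpace
        ↥(pullback g (Spec.map (CommRingCat.ofHom (IsLocalRing.residue R)))) := by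
  let i := Spec.map (CommRingCat.ofHom (IsLocalRing.residue R))
  have : IsClosedImmersion i := IsClosedImmersion.spec_of_surjective _ Ideal.Quotient.mk_surjective
  have hi : Set.range i = {IsLocalRing.closedPoint R} :=
    Set.range_eq_singleton_iff.mpr (IsLocalRing.PrimeSpectrum.comap_residue R)
  have hrange : Set.range (pullback.fst g i) = g ⁻¹' {IsLocalRing.closedPoint R} := by
    rw [Scheme.Pullback.range_fst, hi]
  have hconn := Scheme.isConnected_preimage_closedPoint g
  rw [← hrange, ← Set.image_univ] at hconn
  have h : _root_.IsConnected (Set.univ : Set ↥(pullback g i)) :=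
    ⟨hconn.nonempty.of_image,
      (pullback.fst g i).isEmbedding.isInducing.isPreconnected_image.mp hconn.2⟩
  have := connectedSpace_iff_univ.mpr h
  exact ⟨this.toNonempty, this⟩

end
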